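/- arXiv:2303.12954 — 3 statements merged into one kernel-verified Lean document; each statement's English description precedes it below -/
import Mathlib

section
/- Let p ∈ ℝ[z_1,…,z_m] be real stable and S ⊆ {1,…,m}. Suppose z ∈ ℝ^m lies above the roots of p and there are δ_j > 0 for j ∈ S such that (1/δ_j)·Φ^j_p(z) + (1/2)·(Φ^j_p(z))² ≤ 1 for all j ∈ S. Then the point z + Σ_{j∈S} δ_j·e_j lies above the roots of ∏_{j∈S} (1 − (1/2)·∂²_{z_j}) p. -/
/-- A real polynomial in several variables is real stable if it has no zero with all
coordinates in the open upper half plane. -/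
def RealStable {σ : Type*} (p : MvPolynomial σ ℝ) : Prop :=
  ∀ z : σ → ℂ, (∀ i, 0 < (z i).im) → MvPolynomial.aeval z p ≠ 0

/-- A point `z ∈ ℝ^σ` is above the roots of `Q` if `Q(z + t) > 0` for all `t ≥ 0`. -/
def AboveRoots {σ : Type*} (Q : MvPolynomial σ ℝ) (z : σ → ℝ) : Prop :=
  ∀ t : σ → ℝ, (∀ i, 0 ≤ t i) → 0 < MvPolynomial.eval (z + t) Q

/-- The barrier function `Φ^j_p(z) = ∂_{z_j} p(z) / p(z)`. -/
noncomputable def barrier {σ : Type*} (p : MvPolynomial σ ℝ) (j : σ) (z : σ → ℝ) : ℝ :=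
  MvPolynomial.eval z (MvPolynomial.pderiv j p) / MvPolynomial.eval z p

open Filter Topology Polynomial

/-- The imaginary part of the logarithmic derivative of a complex polynomial, on the real axis. -/
lemma im_logDeriv_eval_ofReal (h : ℂ[X]) (s : ℝ) (hs : h.eval (s : ℂ) ≠ 0) :
    (h.derivative.eval (s : ℂ) / h.eval (s : ℂ)).im =
      (h.roots.map fun μ : ℂ => μ.im / Complex.normSq (s - μ)).sum := by
  rw [(IsAlgClosed.splits h).eval_derivative_div_eval_of_ne_zero hs]
  change Complex.imAddGroupHom _ = _
  rw [map_multiset_sum, Multiset.map_map]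
  refine congrArg _ (Multiset.map_congr rfl fun μ _ => ?_)
  simp [Complex.inv_im]

/-- The real part of the logarithmic derivative of a complex polynomial at the origin. -/
lemma re_logDeriv_eval_zero (h : ℂ[X]) (hs : h.eval 0 ≠ 0) :
    (h.derivative.eval 0 / h.eval 0).re =
      (h.roots.map fun μ : ℂ => -μ.re / Complex.normSq μ).sum := by
  rw [(IsAlgClosed.splits h).eval_derivative_div_eval_of_ne_zero hs]
  change Complex.reAddGroupHom _ = _
  rw [map_multiset_sum, Multiset.map_map]
  refine congrArg _ (Multiset.map_congr rfl fun μ _ => ?_)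
  simp [Complex.inv_re, neg_div]

lemma im_logDeriv_nonpos (h : ℂ[X]) (s : ℝ) (hs : h.eval (s : ℂ) ≠ 0)
    (hroots : ∀ μ ∈ h.roots, μ.im ≤ 0) :
    (h.derivative.eval (s : ℂ) / h.eval (s : ℂ)).im ≤ 0 := by
  rw [im_logDeriv_eval_ofReal h s hs]
  refine (Multiset.sum_map_le_sum_map _ (fun _ => (0 : ℝ)) fun μ hμ => ?_).trans (by simp)
  exact div_nonpos_of_nonpos_of_nonneg (hroots μ hμ) (Complex.normSq_nonneg _)

lemma im_logDeriv_mono (h : ℂ[X]) {s t : ℝ} (hs0 : 0 ≤ s) (hst : s ≤ t)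
    (hs : h.eval (s : ℂ) ≠ 0) (ht : h.eval (t : ℂ) ≠ 0)
    (hroots : ∀ μ ∈ h.roots, μ.im ≤ 0 ∧ μ.re < 0) :
    (h.derivative.eval (s : ℂ) / h.eval (s : ℂ)).im ≤
      (h.derivative.eval (t : ℂ) / h.eval (t : ℂ)).im := by
  rw [im_logDeriv_eval_ofReal h s hs, im_logDeriv_eval_ofReal h t ht]
  refine Multiset.sum_map_le_sum_map _ _ fun μ hμ => ?_
  obtain ⟨h1, h2⟩ := hroots μ hμ
  have h3 : 0 < Complex.normSq (s - μ) := by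
    rw [Complex.normSq_pos]
    intro h0
    have := congrArg Complex.re h0
    simp at this
    linarith
  have h4 : Complex.normSq (s - μ) ≤ Complex.normSq (t - μ) := by
    simp only [Complex.normSq_apply, Complex.sub_re, Complex.sub_im, Complex.ofReal_re,
      Complex.ofReal_im]
    nlinarith
  rw [div_le_div_iff₀ h3 (h3.trans_le h4)]
  nlinarith

/-- A polynomial whose roots lie in the open left half plane grows like `(1 + ‖w‖) ^ natDegree` on
the closed right half plane. -/
lemma exists_pow_le_norm_eval (h : ℂ[X]) (h0 : h ≠ 0) (hroots : ∀ μ ∈ h.roots, μ.re < 0) :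
    ∃ κ > 0, ∀ w : ℂ, 0 ≤ w.re → κ * (1 + ‖w‖) ^ h.natDegree ≤ ‖h.eval w‖ := by
  have key : ∀ m : Multiset ℂ, (∀ μ ∈ m, μ.re < 0) → ∃ κ > 0, ∀ w : ℂ, 0 ≤ w.re →
      κ * (1 + ‖w‖) ^ m.card ≤ ‖(m.map fun μ => w - μ).prod‖ := by
    intro m
    induction m using Multiset.induction with
    | empty => exact fun _ => ⟨1, one_pos, by simp⟩
    | cons a m ih =>
      intro hm
      obtain ⟨κ, hκ, H⟩ := ih fun μ hμ => hm μ (Multiset.mem_cons_of_mem hμ)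
      have ha : 0 < -a.re := by linarith [hm a (Multiset.mem_cons_self a m)]
      set K : ℝ := (1 + ‖a‖) / (-a.re) + 1 with hK
      have hKpos : 0 < K := by positivity
      refine ⟨κ / K, by positivity, fun w hw => ?_⟩
      have h1 : -a.re ≤ ‖w - a‖ := by
        have := Complex.abs_re_le_norm (w - a)
        have := le_abs_self (w - a).re
        simp only [Complex.sub_re] at *
        linarith
      have h2 : ‖w‖ ≤ ‖w - a‖ + ‖a‖ := by simpa using norm_add_le (w - a) a
      have h3 : 1 + ‖w‖ ≤ K * ‖w - a‖ := by
        have : 1 + ‖a‖ ≤ (1 + ‖a‖) / (-a.re) * ‖w - a‖ := by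
          rw [div_mul_eq_mul_div, le_div_iff₀ ha]
          gcongr
        rw [hK, add_mul]
        linarith
      rw [Multiset.map_cons, Multiset.prod_cons, norm_mul, Multiset.card_cons, pow_succ]
      calc κ / K * ((1 + ‖w‖) ^ m.card * (1 + ‖w‖))
          ≤ κ / K * ((1 + ‖w‖) ^ m.card * (K * ‖w - a‖)) := by gcongr
        _ = ‖w - a‖ * (κ * (1 + ‖w‖) ^ m.card) := by field_simp
        _ ≤ _ := by gcongr; exact H w hw
  obtain ⟨κ, hκ, H⟩ := key h.roots hroots
  have hl : 0 < ‖h.leadingCoeff‖ := by simpa using h0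
  refine ⟨‖h.leadingCoeff‖ * κ, by positivity, fun w hw => ?_⟩
  have hsp := IsAlgClosed.splits h
  rw [hsp.eval_eq_prod_roots, norm_mul, hsp.natDegree_eq_card_roots, mul_assoc]
  gcongr
  exact H w hw

lemma norm_eval_le_sum_mul_pow (r : ℂ[X]) {n : ℕ} (hn : r.natDegree ≤ n) (w : ℂ) :
    ‖r.eval w‖ ≤ (∑ k ∈ Finset.range (n + 1), ‖r.coeff k‖) * (1 + ‖w‖) ^ n := by
  rw [eval_eq_sum_range' (Nat.lt_succ_of_le hn), Finset.sum_mul]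
  refine (norm_sum_le _ _).trans (Finset.sum_le_sum fun k hk => ?_)
  rw [norm_mul, norm_pow]
  gcongr
  calc ‖w‖ ^ k ≤ (1 + ‖w‖) ^ k := by gcongr; linarith
    _ ≤ (1 + ‖w‖) ^ n := pow_le_pow_right₀ (by linarith [norm_nonneg w])
      (Nat.lt_succ_iff.1 (Finset.mem_range.1 hk))

lemma aeval_ne_zero_of_im_ne_zero (q : ℝ[X]) (hq : ∀ w : ℂ, 0 < w.im → aeval w q ≠ 0) (w : ℂ)
    (hw : w.im ≠ 0) : aeval w q ≠ 0 := by
  rcases lt_or_gt_of_ne hw with h | h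
  · have := hq (starRingEnd ℂ w) (by simpa using h)
    rwa [aeval_conj, _root_.map_ne_zero] at this
  · exact hq w h

lemma re_neg_of_aeval_eq_zero (q : ℝ[X]) (hpos : ∀ s : ℝ, 0 ≤ s → 0 < q.eval s)
    (hq : ∀ w : ℂ, 0 < w.im → aeval w q ≠ 0) (w : ℂ) (hw : aeval w q = 0) : w.re < 0 := by
  by_contra! hre
  by_cases him : w.im = 0
  · have h1 : w = (algebraMap ℝ ℂ) w.re := Complex.ext (by simp) (by simp [him])
    rw [h1, aeval_algebraMap_apply] at hw
    have := hpos _ hre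
    simp at hw
    linarith
  · exact aeval_ne_zero_of_im_ne_zero q hq w him hw

/-- The logarithmic derivative of `q + iεr` on the real axis, in terms of the Wronskian of `q` and
`r`. -/
lemma im_logDeriv_add_I_mul (q r : ℝ[X]) (ε s : ℝ) :
    ((q.map (algebraMap ℝ ℂ) + C (ε * Complex.I) * r.map (algebraMap ℝ ℂ)).derivative.eval (s : ℂ) /
      (q.map (algebraMap ℝ ℂ) + C (ε * Complex.I) * r.map (algebraMap ℝ ℂ)).eval (s : ℂ)).im =
    ε * ((r.derivative.eval s * q.eval s - q.derivative.eval s * r.eval s) /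
      (q.eval s ^ 2 + ε ^ 2 * r.eval s ^ 2)) := by
  have e : ∀ f : ℝ[X], (f.map (algebraMap ℝ ℂ)).eval (s : ℂ) = ((f.eval s : ℝ) : ℂ) := fun f => by
    rw [eval_map_algebraMap]
    exact aeval_algebraMap_apply ℂ s f
  simp only [derivative_add, derivative_mul, derivative_C, zero_mul, zero_add, derivative_map,
    eval_add, eval_mul, eval_C, e, Complex.div_im, Complex.normSq_apply]
  simp
  ring

lemma im_nonpos_of_root_add_I_mul (q r : ℝ[X])
    (hqr : ∀ w : ℂ, 0 < w.im → aeval w q ≠ 0 ∧ (aeval w r / aeval w q).im ≤ 0)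
    {ε : ℝ} (hε : 0 < ε) (w : ℂ)
    (hw : (q.map (algebraMap ℝ ℂ) + C (ε * Complex.I) * r.map (algebraMap ℝ ℂ)).eval w = 0) :
    w.im ≤ 0 := by
  by_contra! him
  obtain ⟨h0, h1⟩ := hqr w him
  simp only [eval_add, eval_mul, eval_C, eval_map_algebraMap] at hw
  have hF : aeval w r / aeval w q = Complex.I / ε := by
    have : (ε : ℂ) ≠ 0 := by exact_mod_cast hε.ne'
    rw [div_eq_div_iff h0 this]
    linear_combination (-Complex.I) * hw + (ε * aeval w r) * Complex.I_sq
  rw [hF] at h1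
  have : (Complex.I / ε).im = 1 / ε := by
    rw [Complex.div_ofReal_im]; simp
  rw [this] at h1
  have : 0 < 1 / ε := by positivity
  linarith

lemma add_I_mul_eval_ne_zero (q r : ℝ[X]) (ε : ℝ) {s : ℝ} (hs : 0 < q.eval s) :
    (q.map (algebraMap ℝ ℂ) + C (ε * Complex.I) * r.map (algebraMap ℝ ℂ)).eval (s : ℂ) ≠ 0 := by
  have e : ∀ f : ℝ[X], (f.map (algebraMap ℝ ℂ)).eval (s : ℂ) = ((f.eval s : ℝ) : ℂ) := fun f => by
    rw [eval_map_algebraMap]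
    exact aeval_algebraMap_apply ℂ s f
  intro h
  have := congrArg Complex.re h
  simp only [eval_add, eval_mul, eval_C, e] at this
  simp at this
  linarith

lemma wronskian_nonpos (q r : ℝ[X]) {s : ℝ} (hs : 0 < q.eval s)
    (hqr : ∀ w : ℂ, 0 < w.im → aeval w q ≠ 0 ∧ (aeval w r / aeval w q).im ≤ 0) :
    r.derivative.eval s * q.eval s - q.derivative.eval s * r.eval s ≤ 0 := by
  have h1 := im_logDeriv_nonpos _ s (add_I_mul_eval_ne_zero q r 1 hs) fun μ hμ =>
    im_nonpos_of_root_add_I_mul q r hqr one_pos μ (isRoot_of_mem_roots hμ)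
  rw [im_logDeriv_add_I_mul, one_mul] at h1
  by_contra! h2
  have : 0 < q.eval s ^ 2 + 1 ^ 2 * r.eval s ^ 2 := by positivity
  exact absurd h1 (not_le.2 (div_pos h2 this))

lemma hasDerivAt_eval_div_eval (q r : ℝ[X]) {s : ℝ} (hs : 0 < q.eval s) :
    HasDerivAt (fun s => r.eval s / q.eval s)
      ((r.derivative.eval s * q.eval s - q.derivative.eval s * r.eval s) / q.eval s ^ 2) s := by
  simpa only [mul_comm (r.eval s)] using (r.hasDerivAt s).fun_div (q.hasDerivAt s) hs.ne'

lemma antitoneOn_eval_div_eval (q r : ℝ[X]) (hq : ∀ s : ℝ, 0 ≤ s → 0 < q.eval s)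
    (hqr : ∀ w : ℂ, 0 < w.im → aeval w q ≠ 0 ∧ (aeval w r / aeval w q).im ≤ 0) :
    AntitoneOn (fun s => r.eval s / q.eval s) (Set.Ici 0) := by
  refine antitoneOn_of_deriv_nonpos (convex_Ici 0)
    (fun s hs => (hasDerivAt_eval_div_eval q r (hq s hs)).continuousAt.continuousWithinAt)
    (fun s hs => (hasDerivAt_eval_div_eval q r
      (hq s (interior_subset hs))).differentiableAt.differentiableWithinAt) fun s hs => ?_
  have hs' := hq s (interior_subset hs)
  rw [(hasDerivAt_eval_div_eval q r hs').deriv]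
  exact div_nonpos_of_nonpos_of_nonneg (wronskian_nonpos q r hs' hqr) (sq_nonneg _)

lemma natDegree_le_of_eval_div_eval_bounded (q r : ℝ[X]) (hq : q ≠ 0) (B : ℝ)
    (hB : ∀ s : ℝ, 0 ≤ s → |r.eval s / q.eval s| ≤ B) : r.natDegree ≤ q.natDegree := by
  by_contra! hlt
  have h1 := r.abs_div_tendsto_atTop_atTop_of_degree_gt q (degree_lt_degree hlt) hq
  obtain ⟨s, hs0, hs⟩ := ((eventually_ge_atTop 0).and (h1.eventually_gt_atTop B)).exists
  exact absurd (hB s hs0) (not_le.2 hs)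

/-- If `q` is positive and `r` nonnegative on the half line and `r / q` maps the upper half plane
to the closed lower half plane, then `r / q` has nondecreasing derivative on the half line. -/
lemma monotoneOn_wronskian_div_sq (q r : ℝ[X]) (hq : ∀ s : ℝ, 0 ≤ s → 0 < q.eval s)
    (hr : ∀ s : ℝ, 0 ≤ s → 0 ≤ r.eval s)
    (hqr : ∀ w : ℂ, 0 < w.im → aeval w q ≠ 0 ∧ (aeval w r / aeval w q).im ≤ 0) :
    MonotoneOn (fun s => (r.derivative.eval s * q.eval s - q.derivative.eval s * r.eval s) /
      q.eval s ^ 2) (Set.Ici 0) := by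
  have hq0 : q ≠ 0 := by
    rintro rfl
    simpa using hq 0 le_rfl
  have hdeg : r.natDegree ≤ q.natDegree :=
    natDegree_le_of_eval_div_eval_bounded q r hq0 (r.eval 0 / q.eval 0) fun s hs => by
      rw [abs_of_nonneg (div_nonneg (hr s hs) (hq s hs).le)]
      exact antitoneOn_eval_div_eval q r hq hqr Set.self_mem_Ici hs hs
  have hinj := (algebraMap ℝ ℂ).injective
  obtain ⟨κ, hκ, hlow⟩ := exists_pow_le_norm_eval (q.map (algebraMap ℝ ℂ))
    ((Polynomial.map_ne_zero_iff hinj).2 hq0) fun μ hμ => by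
      have := isRoot_of_mem_roots hμ
      rw [IsRoot, eval_map_algebraMap] at this
      exact re_neg_of_aeval_eq_zero q hq (fun w hw => (hqr w hw).1) μ this
  have hup := norm_eval_le_sum_mul_pow (r.map (algebraMap ℝ ℂ)) (n := q.natDegree) (by
    rwa [natDegree_map])
  rw [natDegree_map] at hlow
  set B := ∑ k ∈ Finset.range (q.natDegree + 1), ‖(r.map (algebraMap ℝ ℂ)).coeff k‖ with hBdef
  have hB : 0 ≤ B := by positivity
  have hroots : ∀ ε : ℝ, 0 < ε → ε * B < κ →
      ∀ μ ∈ (q.map (algebraMap ℝ ℂ) + C (ε * Complex.I) * r.map (algebraMap ℝ ℂ)).roots,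
        μ.im ≤ 0 ∧ μ.re < 0 := by
    intro ε hε hεB μ hμ
    have hμ0 := isRoot_of_mem_roots hμ
    refine ⟨im_nonpos_of_root_add_I_mul q r hqr hε μ hμ0, ?_⟩
    by_contra! hre
    rw [IsRoot, eval_add, eval_mul, eval_C, add_eq_zero_iff_eq_neg] at hμ0
    have h1 := hlow μ hre
    rw [hμ0, norm_neg, norm_mul, norm_mul, Complex.norm_I, mul_one, Complex.norm_real,
      Real.norm_of_nonneg hε.le] at h1
    have h2 : ε * ‖(r.map (algebraMap ℝ ℂ)).eval μ‖ ≤ ε * (B * (1 + ‖μ‖) ^ q.natDegree) :=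
      mul_le_mul_of_nonneg_left (hup μ) hε.le
    have h3 : 0 < (1 + ‖μ‖) ^ q.natDegree := by positivity
    nlinarith
  intro s hs t ht hst
  have hs' := hq s hs
  have ht' := hq t ht
  have lim : ∀ u : ℝ, 0 < q.eval u → Tendsto (fun ε : ℝ =>
      (r.derivative.eval u * q.eval u - q.derivative.eval u * r.eval u) /
        (q.eval u ^ 2 + ε ^ 2 * r.eval u ^ 2)) (𝓝[>] 0)
      (𝓝 ((r.derivative.eval u * q.eval u - q.derivative.eval u * r.eval u) / q.eval u ^ 2)) := by
    intro u hu
    have : ContinuousAt (fun ε : ℝ =>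
      (r.derivative.eval u * q.eval u - q.derivative.eval u * r.eval u) /
        (q.eval u ^ 2 + ε ^ 2 * r.eval u ^ 2)) 0 :=
      ContinuousAt.div (by fun_prop) (by fun_prop) (by simp [hu.ne'])
    simpa using this.tendsto.mono_left nhdsWithin_le_nhds
  refine le_of_tendsto_of_tendsto (lim s hs') (lim t ht') ?_
  have hsmall : ∀ᶠ ε : ℝ in 𝓝[>] 0, ε * B < κ := by
    have : Tendsto (fun ε : ℝ => ε * B) (𝓝[>] 0) (𝓝 0) := by
      have : ContinuousAt (fun ε : ℝ => ε * B) 0 := by fun_prop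
      simpa using this.tendsto.mono_left nhdsWithin_le_nhds
    exact this.eventually_lt_const hκ
  filter_upwards [hsmall, self_mem_nhdsWithin] with ε hε1 hε0
  have hε0 : 0 < ε := hε0
  have := im_logDeriv_mono _ hs hst (add_I_mul_eval_ne_zero q r ε hs')
    (add_I_mul_eval_ne_zero q r ε ht') (hroots ε hε0 hε1)
  rw [im_logDeriv_add_I_mul, im_logDeriv_add_I_mul] at this
  exact le_of_mul_le_mul_left this hε0

/-- The restriction of a real polynomial to the line `w ↦ x + w • v`. -/
noncomputable def lineRestrict {σ K : Type*} [CommRing K] [Algebra ℝ K] (p : MvPolynomial σ ℝ)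
    (x v : σ → K) : K[X] :=
  MvPolynomial.aeval (fun k => C (x k) + C (v k) * X) p

section LineRestrict

variable {σ K : Type*} [CommRing K] [Algebra ℝ K]

lemma eval_lineRestrict (p : MvPolynomial σ ℝ) (x v : σ → K) (w : K) :
    (lineRestrict p x v).eval w = MvPolynomial.aeval (fun k => x k + v k * w) p := by
  have := MvPolynomial.comp_aeval_apply (fun k => C (x k) + C (v k) * X)
    ((aeval w : K[X] →ₐ[K] K).restrictScalars ℝ) p
  simpa [lineRestrict, coe_aeval_eq_eval] using this

lemma eval_lineRestrict_real (p : MvPolynomial σ ℝ) (x v : σ → ℝ) (s : ℝ) :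
    (lineRestrict p x v).eval s = MvPolynomial.eval (x + s • v) p := by
  rw [eval_lineRestrict, MvPolynomial.aeval_eq_eval]
  congr 2
  ext k
  simp [mul_comm]

lemma aeval_lineRestrict_real (p : MvPolynomial σ ℝ) (x v : σ → ℝ) (w : ℂ) :
    aeval w (lineRestrict p x v) = MvPolynomial.aeval (fun k => (x k : ℂ) + v k * w) p := by
  have := MvPolynomial.comp_aeval_apply (fun k => C (x k) + C (v k) * X) (aeval w : ℝ[X] →ₐ[ℝ] ℂ) p
  simpa [lineRestrict] using this

lemma natDegree_lineRestrict_le (p : MvPolynomial σ ℝ) (x v : σ → ℝ) :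
    (lineRestrict p x v).natDegree ≤ p.totalDegree := by
  have := MvPolynomial.aeval_natDegree_le (m := p.totalDegree) (n := 1) p le_rfl
    (fun k => C (x k) + C (v k) * X) fun k => by
      rw [add_comm]; exact natDegree_linear_le
  simpa [lineRestrict] using this

lemma derivative_lineRestrict_single [DecidableEq σ] (p : MvPolynomial σ ℝ) (x : σ → K) (j : σ) :
    derivative (lineRestrict p x (Pi.single j 1)) =
      lineRestrict (MvPolynomial.pderiv j p) x (Pi.single j 1) := by
  induction p using MvPolynomial.induction_on with
  | C a =>
    simp [lineRestrict, Polynomial.algebraMap_apply]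
  | add p q hp hq =>
    simp only [lineRestrict, map_add] at *
    rw [hp, hq]
  | mul_X p i hp =>
    simp only [lineRestrict, map_mul, Derivation.leibniz, map_add, smul_eq_mul,
      MvPolynomial.aeval_X, derivative_mul, derivative_C, derivative_X] at *
    rw [hp]
    rcases eq_or_ne i j with rfl | h
    · simp
      ring
    · simp [Pi.single_eq_of_ne h, MvPolynomial.pderiv_X_of_ne h]
      ring

end LineRestrict

lemma norm_eval_zero_le_of_real_rooted (g : ℝ[X]) (hg : ∀ w : ℂ, 0 < w.im → aeval w g ≠ 0)
    {n : ℕ} (hn : g.natDegree ≤ n) (w : ℂ) (hw : 0 < w.im) :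
    (w.im / ‖w‖) ^ n * |g.eval 0| ≤ ‖aeval w g‖ := by
  have hwn : 0 < ‖w‖ := norm_pos_iff.2 (by rintro rfl; simp at hw)
  have hc1 : w.im / ‖w‖ ≤ 1 :=
    (div_le_one hwn).2 ((le_abs_self _).trans (Complex.abs_im_le_norm w))
  have hc0 : 0 ≤ w.im / ‖w‖ := by positivity
  have key : ∀ m : Multiset ℂ, (∀ μ ∈ m, μ.im = 0) →
      (w.im / ‖w‖) ^ m.card * ‖(m.map fun μ => 0 - μ).prod‖ ≤ ‖(m.map fun μ => w - μ).prod‖ := by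
    intro m
    induction m using Multiset.induction with
    | empty => simp
    | cons a m ih =>
      intro hm
      have ih := ih fun μ hμ => hm μ (Multiset.mem_cons_of_mem hμ)
      have ha := hm a (Multiset.mem_cons_self a m)
      have h1 : w.im / ‖w‖ * ‖0 - a‖ ≤ ‖w - a‖ := by
        rw [div_mul_eq_mul_div, div_le_iff₀ hwn]
        refine abs_le_of_sq_le_sq' ?_ (by positivity) |>.2
        rw [mul_pow, mul_pow, ← Complex.normSq_eq_norm_sq, ← Complex.normSq_eq_norm_sq,
          ← Complex.normSq_eq_norm_sq]
        simp only [Complex.normSq_apply, Complex.sub_re, Complex.sub_im, ha, Complex.zero_re,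
          Complex.zero_im]
        nlinarith [sq_nonneg (w.re ^ 2 + w.im ^ 2 - a.re * w.re)]
      simp only [Multiset.map_cons, Multiset.prod_cons, norm_mul, Multiset.card_cons, pow_succ]
      calc _ = (w.im / ‖w‖ * ‖0 - a‖) *
            ((w.im / ‖w‖) ^ m.card * ‖(m.map fun μ => 0 - μ).prod‖) := by ring
        _ ≤ _ := by gcongr
  have hsp := IsAlgClosed.splits (g.map (algebraMap ℝ ℂ))
  have hroots : ∀ μ ∈ (g.map (algebraMap ℝ ℂ)).roots, μ.im = 0 := by
    intro μ hμ
    by_contra him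
    have := isRoot_of_mem_roots hμ
    rw [IsRoot, eval_map_algebraMap] at this
    exact aeval_ne_zero_of_im_ne_zero g hg μ him this
  have h0 : |g.eval 0| = ‖(g.map (algebraMap ℝ ℂ)).eval 0‖ := by
    have := eval_map_apply (f := algebraMap ℝ ℂ) (p := g) 0
    rw [map_zero] at this
    rw [this]
    simp
  rw [h0, ← eval_map_algebraMap, hsp.eval_eq_prod_roots, hsp.eval_eq_prod_roots, norm_mul, norm_mul]
  have hcard : (g.map (algebraMap ℝ ℂ)).roots.card ≤ n :=
    (card_roots' _).trans (natDegree_map_le.trans hn)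
  calc _ = ‖(g.map (algebraMap ℝ ℂ)).leadingCoeff‖ * ((w.im / ‖w‖) ^ n *
          ‖((g.map (algebraMap ℝ ℂ)).roots.map fun μ => 0 - μ).prod‖) := by ring
    _ ≤ ‖(g.map (algebraMap ℝ ℂ)).leadingCoeff‖ *
        ((w.im / ‖w‖) ^ (g.map (algebraMap ℝ ℂ)).roots.card *
          ‖((g.map (algebraMap ℝ ℂ)).roots.map fun μ => 0 - μ).prod‖) := by
      gcongr ?_ * (?_ * ?_)
      exact pow_le_pow_of_le_one hc0 hc1 hcard
    _ ≤ _ := by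
      gcongr
      exact key _ hroots

/-- The logarithmic derivatives of a stable polynomial map the product of upper half planes to the
lower half plane, or vanish. -/
lemma RealStable.pderiv_eq_zero_or_im_neg {σ : Type*} {p : MvPolynomial σ ℝ} (hp : RealStable p)
    (j : σ) (Z : σ → ℂ) (hZ : ∀ i, 0 < (Z i).im) :
    MvPolynomial.aeval Z (MvPolynomial.pderiv j p) = 0 ∨
      (MvPolynomial.aeval Z (MvPolynomial.pderiv j p) / MvPolynomial.aeval Z p).im < 0 := by
  classical
  set g := lineRestrict p Z (Pi.single j 1) with hg
  have hg0 : g.eval 0 = MvPolynomial.aeval Z p := by simp [hg, eval_lineRestrict]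
  have hg1 : g.derivative.eval 0 = MvPolynomial.aeval Z (MvPolynomial.pderiv j p) := by
    rw [hg, derivative_lineRestrict_single, eval_lineRestrict]
    simp
  have hne : g.eval 0 ≠ 0 := hg0 ▸ hp Z hZ
  have hroots : ∀ μ ∈ g.roots, μ.im < 0 := by
    intro μ hμ
    by_contra! him
    have := isRoot_of_mem_roots hμ
    rw [IsRoot, hg, eval_lineRestrict] at this
    refine hp _ (fun i => ?_) this
    rcases eq_or_ne i j with rfl | h
    · simpa using add_pos_of_pos_of_nonneg (hZ i) him
    · simpa [Pi.single_eq_of_ne h] using hZ i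
  by_cases hempty : g.roots = 0
  · left
    rw [← hg1, (IsAlgClosed.splits g).eval_derivative_eq_eval_mul_sum hne, hempty]
    simp
  · right
    rw [← hg1, ← hg0]
    have := im_logDeriv_eval_ofReal g 0 (by simpa using hne)
    simp only [Complex.ofReal_zero] at this
    rw [this]
    obtain ⟨a, ha⟩ := Multiset.exists_mem_of_ne_zero hempty
    have : (g.roots.map fun μ : ℂ => μ.im / Complex.normSq (0 - μ)).sum <
        (g.roots.map fun _ : ℂ => (0 : ℝ)).sum := by
      refine Multiset.sum_lt_sum_of_nonempty hempty fun μ hμ => ?_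
      refine div_neg_of_neg_of_pos (hroots μ hμ) (Complex.normSq_pos.2 ?_)
      intro h
      have h1 := congrArg Complex.im h
      have h2 := hroots μ hμ
      simp at h1
      linarith
    simpa using this

lemma RealStable.im_pderiv_div_nonpos {σ : Type*} {p : MvPolynomial σ ℝ} (hp : RealStable p)
    (j : σ) (Z : σ → ℂ) (hZ : ∀ i, 0 < (Z i).im) :
    (MvPolynomial.aeval Z (MvPolynomial.pderiv j p) / MvPolynomial.aeval Z p).im ≤ 0 := by
  rcases hp.pderiv_eq_zero_or_im_neg j Z hZ with h | h
  · simp [h]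
  · exact h.le

lemma RealStable.add_smul_pderiv {σ : Type*} {p : MvPolynomial σ ℝ} (hp : RealStable p) (c : ℝ)
    (j : σ) : RealStable (p + c • MvPolynomial.pderiv j p) := by
  intro Z hZ h0
  have hne := hp Z hZ
  rw [map_add, map_smul, Complex.real_smul] at h0
  rcases hp.pderiv_eq_zero_or_im_neg j Z hZ with h | h
  · rw [h] at h0
    exact hne (by simpa using h0)
  · rcases eq_or_ne c 0 with rfl | hc
    · exact hne (by simpa using h0)
    · have hcc : (c : ℂ) ≠ 0 := by exact_mod_cast hc
      have : MvPolynomial.aeval Z (MvPolynomial.pderiv j p) / MvPolynomial.aeval Z p =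
          ((-1 / c : ℝ) : ℂ) := by
        push_cast
        rw [div_eq_div_iff hne hcc]
        linear_combination h0
      rw [this, Complex.ofReal_im] at h
      exact lt_irrefl _ h

lemma continuous_aeval_line {σ : Type*} (p : MvPolynomial σ ℝ) (x v : σ → ℝ)
    (w : ℂ) : Continuous fun η : ℝ =>
      MvPolynomial.aeval (fun k => (x k : ℂ) + (v k + η : ℝ) * w) p := by
  have h : Continuous fun η : ℝ => fun k => (x k : ℂ) + (v k + η : ℝ) * w := by fun_prop
  have := (MvPolynomial.continuous_eval (p.map (algebraMap ℝ ℂ))).comp h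
  refine this.congr fun η => ?_
  simp [MvPolynomial.aeval_def, MvPolynomial.eval_map]

lemma RealStable.aeval_line_ne_zero {σ : Type*} {p : MvPolynomial σ ℝ} (hp : RealStable p)
    (x v : σ → ℝ) (hx : MvPolynomial.eval x p ≠ 0) (hv : ∀ i, 0 ≤ v i) (w : ℂ) (hw : 0 < w.im) :
    MvPolynomial.aeval (fun k => (x k : ℂ) + v k * w) p ≠ 0 := by
  have hwn : 0 < ‖w‖ := norm_pos_iff.2 (by rintro rfl; simp at hw)
  have h1 : ∀ η : ℝ, 0 < η → (w.im / ‖w‖) ^ p.totalDegree * |MvPolynomial.eval x p| ≤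
      ‖MvPolynomial.aeval (fun k => (x k : ℂ) + (v k + η : ℝ) * w) p‖ := by
    intro η hη
    have := norm_eval_zero_le_of_real_rooted (lineRestrict p x (fun k => v k + η))
      (fun u hu => ?_) (natDegree_lineRestrict_le _ _ _) w hw
    · rwa [eval_lineRestrict_real, zero_smul, add_zero, aeval_lineRestrict_real] at this
    · rw [aeval_lineRestrict_real]
      refine hp _ fun i => ?_
      have : 0 < v i + η := by linarith [hv i]
      rw [Complex.add_im, Complex.ofReal_im, zero_add, Complex.im_ofReal_mul]
      positivity
  have h2 : Tendsto (fun η : ℝ =>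
      ‖MvPolynomial.aeval (fun k => (x k : ℂ) + (v k + η : ℝ) * w) p‖) (𝓝[>] 0)
      (𝓝 ‖MvPolynomial.aeval (fun k => (x k : ℂ) + v k * w) p‖) := by
    have := ((continuous_aeval_line p x v w).norm.tendsto 0).mono_left
      (nhdsWithin_le_nhds (s := Set.Ioi 0))
    simpa using this
  have h3 := ge_of_tendsto h2 (by
    filter_upwards [self_mem_nhdsWithin] with η hη using h1 η hη)
  have h4 : 0 < (w.im / ‖w‖) ^ p.totalDegree * |MvPolynomial.eval x p| := by positivity
  exact norm_pos_iff.1 (h4.trans_le h3)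

lemma RealStable.im_line_nonpos {σ : Type*} {p : MvPolynomial σ ℝ} (hp : RealStable p)
    (x v : σ → ℝ) (hx : MvPolynomial.eval x p ≠ 0) (hv : ∀ i, 0 ≤ v i) (j : σ) (w : ℂ)
    (hw : 0 < w.im) :
    aeval w (lineRestrict p x v) ≠ 0 ∧
    (aeval w (lineRestrict (MvPolynomial.pderiv j p) x v) / aeval w (lineRestrict p x v)).im ≤ 0 := by
  have hne := hp.aeval_line_ne_zero x v hx hv w hw
  rw [aeval_lineRestrict_real, aeval_lineRestrict_real]
  refine ⟨hne, ?_⟩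
  have h1 : ContinuousAt (fun η : ℝ =>
      (MvPolynomial.aeval (fun k => (x k : ℂ) + (v k + η : ℝ) * w) (MvPolynomial.pderiv j p) /
        MvPolynomial.aeval (fun k => (x k : ℂ) + (v k + η : ℝ) * w) p).im) 0 := by
    refine Complex.continuous_im.continuousAt.comp
      (ContinuousAt.div (continuous_aeval_line _ x v w).continuousAt
        (continuous_aeval_line _ x v w).continuousAt ?_)
    simpa using hne
  have h2 := h1.tendsto.mono_left (nhdsWithin_le_nhds (s := Set.Ioi 0))
  simp only [add_zero] at h2
  refine le_of_tendsto h2 ?_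
  filter_upwards [self_mem_nhdsWithin] with η hη
  refine hp.im_pderiv_div_nonpos j _ fun i => ?_
  have : 0 < v i + η := add_pos_of_nonneg_of_pos (hv i) hη
  rw [Complex.add_im, Complex.ofReal_im, zero_add, Complex.im_ofReal_mul]
  positivity

section Barrier

variable {σ : Type*} {p : MvPolynomial σ ℝ} {x : σ → ℝ}

lemma AboveRoots.eval_pos (hx : AboveRoots p x) : 0 < MvPolynomial.eval x p := by
  simpa using hx 0 fun _ => le_rfl

lemma AboveRoots.add (hx : AboveRoots p x) {t : σ → ℝ} (ht : ∀ i, 0 ≤ t i) :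
    AboveRoots p (x + t) := fun u hu => by
  rw [add_assoc]
  exact hx _ fun i => add_nonneg (ht i) (hu i)

lemma AboveRoots.eval_lineRestrict_pos (hx : AboveRoots p x) {v : σ → ℝ} (hv : ∀ i, 0 ≤ v i)
    (s : ℝ) (hs : 0 ≤ s) : 0 < (lineRestrict p x v).eval s := by
  rw [eval_lineRestrict_real]
  exact hx _ fun i => mul_nonneg hs (hv i)

lemma single_one_nonneg [DecidableEq σ] (j i : σ) : 0 ≤ (Pi.single j 1 : σ → ℝ) i := by
  rcases eq_or_ne i j with rfl | h <;> simp [*]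

lemma RealStable.eval_pderiv_nonneg (hp : RealStable p) (hx : AboveRoots p x) (j : σ) :
    0 ≤ MvPolynomial.eval x (MvPolynomial.pderiv j p) := by
  classical
  set g := lineRestrict p x (Pi.single j 1) with hg
  have e : ∀ f : ℝ[X], (f.map (algebraMap ℝ ℂ)).eval 0 = ((f.eval 0 : ℝ) : ℂ) := fun f => by
    simpa using eval_map_apply (f := algebraMap ℝ ℂ) (p := f) 0
  have hpos := hx.eval_lineRestrict_pos (single_one_nonneg j)
  have h0 := hpos 0 le_rfl
  have hre := re_logDeriv_eval_zero (g.map (algebraMap ℝ ℂ)) (by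
    rw [e]; exact_mod_cast h0.ne')
  rw [derivative_map, e, e, ← Complex.ofReal_div, Complex.ofReal_re] at hre
  have hsum : (0 : ℝ) ≤ g.derivative.eval 0 / g.eval 0 := by
    rw [hre]
    refine le_trans (by simp) (Multiset.sum_map_le_sum_map (fun _ => (0 : ℝ)) _ fun μ hμ => ?_)
    have := isRoot_of_mem_roots hμ
    rw [IsRoot, eval_map_algebraMap] at this
    have hneg := re_neg_of_aeval_eq_zero g hpos
      (fun w hw => (hp.im_line_nonpos x _ hx.eval_pos.ne' (single_one_nonneg j) j w hw).1) μ this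
    exact div_nonneg (by linarith) (Complex.normSq_nonneg _)
  have := mul_nonneg hsum h0.le
  rw [div_mul_cancel₀ _ h0.ne', hg, derivative_lineRestrict_single, eval_lineRestrict_real] at this
  simpa using this

lemma RealStable.barrier_nonneg (hp : RealStable p) (hx : AboveRoots p x) (j : σ) :
    0 ≤ barrier p j x :=
  div_nonneg (hp.eval_pderiv_nonneg hx j) hx.eval_pos.le

lemma RealStable.barrier_add_le (hp : RealStable p) (hx : AboveRoots p x) (j : σ) {v : σ → ℝ}
    (hv : ∀ i, 0 ≤ v i) : barrier p j (x + v) ≤ barrier p j x := by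
  have := antitoneOn_eval_div_eval (lineRestrict p x v)
    (lineRestrict (MvPolynomial.pderiv j p) x v) (hx.eval_lineRestrict_pos hv)
    (hp.im_line_nonpos x v hx.eval_pos.ne' hv j) Set.self_mem_Ici
    (Set.mem_Ici.2 zero_le_one) zero_le_one
  simpa [eval_lineRestrict_real, barrier] using this

/-- The barrier functions are nonincreasing in every coordinate, in terms of the polynomial. -/
lemma RealStable.eval_pderiv_pderiv_mul_le (hp : RealStable p) (hx : AboveRoots p x) (i j : σ) :
    MvPolynomial.eval x (MvPolynomial.pderiv i (MvPolynomial.pderiv j p)) *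
      MvPolynomial.eval x p ≤
    MvPolynomial.eval x (MvPolynomial.pderiv i p) *
      MvPolynomial.eval x (MvPolynomial.pderiv j p) := by
  classical
  have := wronskian_nonpos (lineRestrict p x (Pi.single i 1))
    (lineRestrict (MvPolynomial.pderiv j p) x (Pi.single i 1))
    (hx.eval_lineRestrict_pos (single_one_nonneg i) 0 le_rfl)
    (hp.im_line_nonpos x _ hx.eval_pos.ne' (single_one_nonneg i) j)
  simp only [derivative_lineRestrict_single, eval_lineRestrict_real, zero_smul, add_zero] at this
  linarith

/-- Convexity of the barrier functions in every coordinate: the tangent inequality and the sign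
of the second derivative, at the point `x + δ • eᵢ`. -/
lemma RealStable.barrier_convex [DecidableEq σ] (hp : RealStable p) (hx : AboveRoots p x)
    (i j : σ) {δ : ℝ} (hδ : 0 < δ) {y : σ → ℝ} (hy : y = x + δ • (Pi.single i 1 : σ → ℝ))
    {a ai aj aii aij aiij : ℝ} (ha : a = MvPolynomial.eval y p)
    (hai : ai = MvPolynomial.eval y (MvPolynomial.pderiv i p))
    (haj : aj = MvPolynomial.eval y (MvPolynomial.pderiv j p))
    (haii : aii = MvPolynomial.eval y (MvPolynomial.pderiv i (MvPolynomial.pderiv i p)))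
    (haij : aij = MvPolynomial.eval y (MvPolynomial.pderiv i (MvPolynomial.pderiv j p)))
    (haiij : aiij = MvPolynomial.eval y
      (MvPolynomial.pderiv i (MvPolynomial.pderiv i (MvPolynomial.pderiv j p)))) :
    aj / a - δ * ((aij * a - ai * aj) / a ^ 2) ≤ barrier p j x ∧
      0 ≤ (aiij * a - aii * aj) * a - 2 * ai * (aij * a - ai * aj) := by
  set v : σ → ℝ := Pi.single i 1 with hv
  set q := lineRestrict p x v with hq
  set r := lineRestrict (MvPolynomial.pderiv j p) x v with hr
  have hqpos := hx.eval_lineRestrict_pos (single_one_nonneg i)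
  have hqr := hp.im_line_nonpos x v hx.eval_pos.ne' (single_one_nonneg i) j
  have hmono := monotoneOn_wronskian_div_sq q r hqpos (fun s hs => by
    rw [hr, eval_lineRestrict_real]
    exact hp.eval_pderiv_nonneg
      (hx.add fun k => mul_nonneg hs (single_one_nonneg i k)) j) hqr
  have hF : ∀ s, 0 ≤ s → HasDerivAt (fun s => r.eval s / q.eval s) _ s := fun s hs =>
    hasDerivAt_eval_div_eval q r (hqpos s hs)
  have eq0 : q.eval δ = a := by rw [ha, hq, eval_lineRestrict_real, hy]
  have eq1 : q.derivative.eval δ = ai := by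
    rw [hai, hq, derivative_lineRestrict_single, eval_lineRestrict_real, hy]
  have eq2 : q.derivative.derivative.eval δ = aii := by
    rw [haii, hq, derivative_lineRestrict_single, derivative_lineRestrict_single,
      eval_lineRestrict_real, hy]
  have er0 : r.eval δ = aj := by rw [haj, hr, eval_lineRestrict_real, hy]
  have er1 : r.derivative.eval δ = aij := by
    rw [haij, hr, derivative_lineRestrict_single, eval_lineRestrict_real, hy]
  have er2 : r.derivative.derivative.eval δ = aiij := by
    rw [haiij, hr, derivative_lineRestrict_single, derivative_lineRestrict_single,
      eval_lineRestrict_real, hy]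
  have hapos : 0 < a := eq0 ▸ hqpos δ hδ.le
  constructor
  · obtain ⟨c, hc, hceq⟩ := exists_hasDerivAt_eq_slope (fun s => r.eval s / q.eval s) _ hδ
      (fun s hs => (hF s hs.1).continuousAt.continuousWithinAt) fun s hs => hF s hs.1.le
    have hle := hmono (Set.mem_Ici.2 hc.1.le) (Set.mem_Ici.2 hδ.le) hc.2.le
    simp only [hceq, eq0, eq1, er0, er1, sub_zero] at hle
    rw [div_le_iff₀ hδ] at hle
    have : r.eval 0 / q.eval 0 = barrier p j x := by
      simp [hr, hq, eval_lineRestrict_real, barrier]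
    linarith
  · have hd : HasDerivAt (fun s => (r.derivative.eval s * q.eval s -
        q.derivative.eval s * r.eval s) / q.eval s ^ 2)
        (((aiij * a + aij * ai - (aii * aj + ai * aij)) * a ^ 2 -
          (aij * a - ai * aj) * (2 * a * ai)) / (a ^ 2) ^ 2) δ := by
      have := ((((r.derivative.hasDerivAt δ).fun_mul (q.hasDerivAt δ)).fun_sub
        ((q.derivative.hasDerivAt δ).fun_mul (r.hasDerivAt δ))).fun_div
        ((q.hasDerivAt δ).fun_pow 2) (by rw [eq0]; positivity))
      simpa [eq0, eq1, eq2, er0, er1, er2] using this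
    have h0 : 0 ≤ deriv (fun s => (r.derivative.eval s * q.eval s -
        q.derivative.eval s * r.eval s) / q.eval s ^ 2) δ := by
      have hnhds : Set.Ici (0 : ℝ) ∈ 𝓝 δ := Ici_mem_nhds hδ
      have := hmono.derivWithin_nonneg (x := δ)
      rwa [derivWithin_of_mem_nhds hnhds] at this
    rw [hd.deriv] at h0
    have h1 := mul_nonneg h0 (show 0 ≤ (a ^ 2) ^ 2 by positivity)
    rw [div_mul_cancel₀ _ (by positivity)] at h1
    refine le_of_mul_le_mul_left (a := a) ?_ hapos
    linarith

/-- The operator `1 - ½ ∂ⱼ²`. -/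
noncomputable abbrev subHalfPderivSq (j : σ) : Module.End ℝ (MvPolynomial σ ℝ) :=
  (1 : Module.End ℝ (MvPolynomial σ ℝ)) -
    (1 / 2 : ℝ) • ((MvPolynomial.pderiv j).toLinearMap ∘ₗ (MvPolynomial.pderiv j).toLinearMap)

lemma subHalfPderivSq_apply (j : σ) (p : MvPolynomial σ ℝ) : subHalfPderivSq j p =
    p - (1 / 2 : ℝ) • MvPolynomial.pderiv j (MvPolynomial.pderiv j p) := rfl

lemma RealStable.apply_subHalfPderivSq (hp : RealStable p) (j : σ) :
    RealStable (subHalfPderivSq j p) := by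
  have h := (hp.add_smul_pderiv (√(1 / 2)) j).add_smul_pderiv (-√(1 / 2)) j
  have hsq : √(1 / 2 : ℝ) * √(1 / 2) = 1 / 2 := Real.mul_self_sqrt (by norm_num)
  convert h using 1
  rw [subHalfPderivSq_apply, map_add, Derivation.map_smul, smul_add, smul_smul, neg_mul, hsq, neg_smul,
    neg_smul]
  abel

lemma pderiv_pderiv_comm (i j : σ) (p : MvPolynomial σ ℝ) :
    MvPolynomial.pderiv i (MvPolynomial.pderiv j p) =
      MvPolynomial.pderiv j (MvPolynomial.pderiv i p) := by
  have h : ⁅(MvPolynomial.pderiv i : Derivation ℝ (MvPolynomial σ ℝ) (MvPolynomial σ ℝ)),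
      (MvPolynomial.pderiv j : Derivation ℝ (MvPolynomial σ ℝ) (MvPolynomial σ ℝ))⁆ = 0 := by
    classical
    refine MvPolynomial.derivation_ext (R := ℝ) (A := MvPolynomial σ ℝ) fun k => ?_
    rw [Derivation.commutator_apply, MvPolynomial.pderiv_X, MvPolynomial.pderiv_X]
    simp only [Pi.single_apply]
    split_ifs <;> simp
  have := congrArg (fun D => D p) h
  rw [Derivation.commutator_apply] at this
  exact sub_eq_zero.1 this

/-- Single barrier shift for the operator `1 - ½ ∂ⱼ²`. -/
lemma RealStable.barrier_shift [DecidableEq σ] (hp : RealStable p) (hx : AboveRoots p x) (j : σ)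
    {δ : ℝ} (hδ : 0 < δ) (hb : (1 / δ) * barrier p j x + (1 / 2) * barrier p j x ^ 2 ≤ 1) :
    AboveRoots (subHalfPderivSq j p) (x + δ • (Pi.single j 1 : σ → ℝ)) ∧
      ∀ k, barrier (subHalfPderivSq j p) k (x + δ • (Pi.single j 1 : σ → ℝ)) ≤ barrier p k x := by
  have hs : ∀ i, 0 ≤ (δ • (Pi.single j 1 : σ → ℝ)) i := fun i =>
    mul_nonneg hδ.le (single_one_nonneg j i)
  have hb0 := hp.barrier_nonneg hx j
  have hb1 : barrier p j x ≤ δ * (1 - 1 / 2 * barrier p j x ^ 2) := by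
    rw [one_div_mul_eq_div] at hb
    have := (div_le_iff₀' hδ).1 (le_sub_iff_add_le.2 hb)
    exact this
  have hb2 : 0 < 1 - 1 / 2 * barrier p j x ^ 2 := by
    rcases hb0.eq_or_lt with h | h
    · rw [← h]; norm_num
    · exact pos_of_mul_pos_right (h.trans_le hb1) hδ.le
  have key : ∀ t : σ → ℝ, (∀ i, 0 ≤ t i) →
      MvPolynomial.eval (x + t) (MvPolynomial.pderiv j (MvPolynomial.pderiv j p)) ≤
        barrier p j x ^ 2 * MvPolynomial.eval (x + t) p := by
    intro t ht
    have hy := hx.add ht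
    have hpos := hy.eval_pos
    have h1 := hp.eval_pderiv_pderiv_mul_le hy j j
    have h2 := hp.barrier_add_le hx j ht
    have h3 := hp.eval_pderiv_nonneg hy j
    rw [barrier, div_le_iff₀ hpos] at h2
    have h4 := mul_le_mul h2 h2 h3 (by positivity)
    nlinarith
  have hev : ∀ y, MvPolynomial.eval y (subHalfPderivSq j p) = MvPolynomial.eval y p -
      1 / 2 * MvPolynomial.eval y (MvPolynomial.pderiv j (MvPolynomial.pderiv j p)) := fun y => by
    rw [subHalfPderivSq_apply, map_sub, MvPolynomial.smul_eval]
  refine ⟨fun t ht => ?_, fun k => ?_⟩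
  · rw [hev, add_assoc]
    have ht' : ∀ i, 0 ≤ (δ • (Pi.single j 1 : σ → ℝ) + t) i := fun i => add_nonneg (hs i) (ht i)
    have h1 := key _ ht'
    have h2 := mul_pos hb2 (hx.add ht').eval_pos
    linarith
  · have hy := hx.add hs
    have hkey := key _ hs
    have hmon := hp.barrier_add_le hx j hs
    obtain ⟨h1, h2⟩ := hp.barrier_convex hx j k hδ rfl rfl rfl rfl rfl rfl rfl
    have h3 := hp.eval_pderiv_pderiv_mul_le hy j k
    have hn := hp.eval_pderiv_nonneg hy j
    have hpos := hy.eval_pos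
    refine le_trans ?_ h1
    have hnum : MvPolynomial.eval (x + δ • (Pi.single j 1 : σ → ℝ))
        (MvPolynomial.pderiv k (subHalfPderivSq j p)) =
        MvPolynomial.eval (x + δ • (Pi.single j 1 : σ → ℝ)) (MvPolynomial.pderiv k p) -
        1 / 2 * MvPolynomial.eval (x + δ • (Pi.single j 1 : σ → ℝ)) (MvPolynomial.pderiv j
          (MvPolynomial.pderiv j (MvPolynomial.pderiv k p))) := by
      rw [subHalfPderivSq_apply, map_sub, Derivation.map_smul, pderiv_pderiv_comm k j,
        pderiv_pderiv_comm k j, map_sub, MvPolynomial.smul_eval]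
    rw [barrier, hnum, hev]
    rw [barrier, div_le_iff₀ hpos] at hmon
    generalize x + δ • (Pi.single j 1 : σ → ℝ) = y at *
    generalize MvPolynomial.eval y p = a at *
    generalize MvPolynomial.eval y (MvPolynomial.pderiv j p) = aj at *
    generalize MvPolynomial.eval y (MvPolynomial.pderiv k p) = ak at *
    generalize MvPolynomial.eval y (MvPolynomial.pderiv j (MvPolynomial.pderiv j p)) = ajj at *
    generalize MvPolynomial.eval y (MvPolynomial.pderiv j (MvPolynomial.pderiv k p)) = ajk at *
    generalize MvPolynomial.eval y (MvPolynomial.pderiv j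
      (MvPolynomial.pderiv j (MvPolynomial.pderiv k p))) = ajjk at *
    generalize barrier p j x = b at *
    have hden : 0 < a - 1 / 2 * ajj := by linarith [mul_pos hb2 hpos]
    set D := aj * ak - ajk * a with hD
    have hD0 : 0 ≤ D := by linarith
    have hR : ak / a - δ * ((ajk * a - aj * ak) / a ^ 2) = (ak * a + δ * D) / a ^ 2 := by
      rw [hD]; field_simp; ring
    rw [hR, div_le_div_iff₀ hden (by positivity)]
    have hajδ : aj ≤ δ * (a - 1 / 2 * ajj) :=
      calc aj ≤ b * a := hmon
        _ ≤ δ * (1 - 1 / 2 * b ^ 2) * a := by gcongr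
        _ = δ * (a - 1 / 2 * (b ^ 2 * a)) := by ring
        _ ≤ _ := by gcongr
    have h4 := mul_le_mul_of_nonneg_right hajδ hD0
    nlinarith

lemma RealStable.barrier_shift_list [DecidableEq σ] (hp : RealStable p) (hx : AboveRoots p x)
    (δ : σ → ℝ) (L : List σ) (hδ : ∀ j ∈ L, 0 < δ j)
    (hb : ∀ j ∈ L, (1 / δ j) * barrier p j x + (1 / 2) * barrier p j x ^ 2 ≤ 1) :
    RealStable ((L.map fun j => subHalfPderivSq j).prod p) ∧
      AboveRoots ((L.map fun j => subHalfPderivSq j).prod p)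
        (x + (L.map fun j => δ j • (Pi.single j 1 : σ → ℝ)).sum) ∧
      ∀ k, barrier ((L.map fun j => subHalfPderivSq j).prod p) k
        (x + (L.map fun j => δ j • (Pi.single j 1 : σ → ℝ)).sum) ≤ barrier p k x := by
  induction L with
  | nil => simpa using ⟨hp, hx⟩
  | cons j L ih =>
    obtain ⟨h1, h2, h3⟩ := ih (fun i hi => hδ i (List.mem_cons_of_mem j hi))
      fun i hi => hb i (List.mem_cons_of_mem j hi)
    have hδj := hδ j List.mem_cons_self
    have hbj := hb j List.mem_cons_self
    rw [List.map_cons, List.map_cons, List.prod_cons, List.sum_cons, Module.End.mul_apply,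
      add_comm (δ j • _), ← add_assoc]
    have h0 := h1.barrier_nonneg h2 j
    obtain ⟨h4, h5⟩ := h1.barrier_shift h2 j hδj (by
      refine le_trans ?_ hbj
      have := h3 j
      gcongr)
    exact ⟨h1.apply_subHalfPderivSq j, h4, fun k => (h5 k).trans (h3 k)⟩

end Barrier

/-- iterated barrier shift for the operators `1 − ½∂²_{z_j}`, `j ∈ S`
(Corollary `AG10`). -/
theorem statement14 {m : ℕ} (p : MvPolynomial (Fin m) ℝ) (hp : RealStable p)
    (S : Finset (Fin m)) (z : Fin m → ℝ) (hz : AboveRoots p z)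
    (δ : Fin m → ℝ) (hδ : ∀ j ∈ S, 0 < δ j)
    (hbar : ∀ j ∈ S, (1 / δ j) * barrier p j z + (1 / 2) * (barrier p j z) ^ 2 ≤ 1) :
    AboveRoots
      ((S.toList.map fun j =>
          ((1 : Module.End ℝ (MvPolynomial (Fin m) ℝ)) -
            (1 / 2 : ℝ) • ((MvPolynomial.pderiv j).toLinearMap ∘ₗ
              (MvPolynomial.pderiv j).toLinearMap) :
            Module.End ℝ (MvPolynomial (Fin m) ℝ))).prod p)
      (z + ∑ j ∈ S, δ j • (Pi.single j 1 : Fin m → ℝ)) := by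
  have h := (hp.barrier_shift_list hz δ S.toList (fun j hj => hδ j (Finset.mem_toList.1 hj))
    fun j hj => hbar j (Finset.mem_toList.1 hj)).2.1
  rwa [Finset.sum_map_toList] at h
end

section
/- Let p ∈ ℝ[x_1,…,x_n, z, w] be a real stable polynomial and (t_1,…,t_n) ∈ ℝ^n. If the point (t_1,…,t_n, 0, 0) is above the roots of p, and (t_1,…,t_n) is above the roots of the polynomial obtained from p by identifying w with z, applying (1 − (1/2)·∂²_z), and setting z = 0, then (t_1,…,t_n) is also above the roots of the polynomial (1 − ∂_z ∂_w) p restricted to z = w = 0. -/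
open MvPolynomial in
/-- Chain rule for a polynomial substitution into univariate polynomials. -/
theorem derivative_aeval_eq_sum {σ : Type*} [Fintype σ] (L : σ → Polynomial ℝ)
    (p : MvPolynomial σ ℝ) :
    Polynomial.derivative (aeval L p) =
      ∑ i, Polynomial.derivative (L i) * aeval L (pderiv i p) := by
  classical
  induction p using MvPolynomial.induction_on with
  | C a => simp
  | add p q hp hq => simp [hp, hq, mul_add, Finset.sum_add_distrib]
  | mul_X p j hp =>
    simp only [map_mul, aeval_X, Polynomial.derivative_mul, hp, Derivation.leibniz, pderiv_X,
      smul_eq_mul, map_add, mul_add, Finset.sum_add_distrib, Finset.sum_mul]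
    rw [add_comm]
    congr 1
    · rw [Finset.sum_eq_single j]
      · simp [mul_comm]
      · intro b _ hb
        simp [Pi.single_eq_of_ne hb.symm]
      · simp
    · exact Finset.sum_congr rfl fun i _ => by ring

/-- A real polynomial that is positive at zero and all of whose complex roots are negative reals
has nonnegative coefficients. -/
theorem coeff_nonneg_of_roots_neg (N : ℕ) (g : Polynomial ℝ) (hN : g.natDegree = N)
    (h0 : 0 < g.eval 0)
    (hr : ∀ z : ℂ, Polynomial.aeval z g = 0 → ∃ r : ℝ, r < 0 ∧ z = r) (k : ℕ) :
    0 ≤ g.coeff k := by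
  induction N generalizing g k with
  | zero =>
    rw [Polynomial.eq_C_of_natDegree_eq_zero hN] at h0 ⊢
    rw [Polynomial.eval_C] at h0
    rw [Polynomial.coeff_C]
    split_ifs
    exacts [h0.le, le_rfl]
  | succ N ih =>
    obtain ⟨z, hz⟩ := IsAlgClosed.exists_aeval_eq_zero ℂ g
      (fun h => by simp [Polynomial.natDegree_eq_of_degree_eq_some h] at hN)
    obtain ⟨r, hr0, rfl⟩ := hr z hz
    have hroot : g.IsRoot r := by
      have h := Polynomial.aeval_algebraMap_apply ℂ r g
      rw [Complex.coe_algebraMap, hz] at h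
      simpa [Polynomial.IsRoot] using h.symm
    obtain ⟨h, rfl⟩ := Polynomial.dvd_iff_isRoot.mpr hroot
    have hh : h ≠ 0 := by rintro rfl; simp at h0
    have hdeg : h.natDegree = N := by
      rw [Polynomial.natDegree_mul (Polynomial.X_sub_C_ne_zero r) hh,
        Polynomial.natDegree_X_sub_C] at hN
      omega
    have hpos : 0 < h.eval 0 := by
      simp only [Polynomial.eval_mul, Polynomial.eval_sub, Polynomial.eval_X,
        Polynomial.eval_C, zero_sub] at h0
      exact pos_of_mul_pos_right h0 (by linarith)
    have hc := ih h hdeg hpos fun z hz => hr z (by simp [hz])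
    rw [sub_mul]
    cases k with
    | zero =>
      simp only [Polynomial.coeff_sub, Polynomial.mul_coeff_zero, Polynomial.coeff_X_zero,
        Polynomial.coeff_C_zero]
      nlinarith [hc 0]
    | succ k =>
      simp only [Polynomial.coeff_sub, Polynomial.coeff_X_mul, Polynomial.coeff_C_mul]
      nlinarith [hc k, hc (k + 1)]

open MvPolynomial in
/-- At a point above the roots of a real stable polynomial, the second derivative in every
strictly positive direction is nonnegative. -/
theorem RealStable.second_directional_deriv_nonneg_of_pos {σ : Type*} [Fintype σ]
    {p : MvPolynomial σ ℝ} (hp : RealStable p) {a : σ → ℝ} (ha : AboveRoots p a)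
    {v : σ → ℝ} (hv : ∀ i, 0 < v i) :
    0 ≤ ∑ i, v i * ∑ j, v j * eval a (pderiv j (pderiv i p)) := by
  let L : σ → Polynomial ℝ := fun i => Polynomial.C (a i) + Polynomial.C (v i) * Polynomial.X
  have hL : ∀ i, Polynomial.derivative (L i) = Polynomial.C (v i) := fun i => by simp [L]
  have heval : ∀ (s : ℝ) (q : MvPolynomial σ ℝ),
      (aeval L q).eval s = eval (fun i => a i + v i * s) q := fun s q => by
    rw [← Polynomial.coe_evalRingHom, map_aeval]
    simp only [L, Polynomial.coe_evalRingHom, Polynomial.eval_add, Polynomial.eval_mul,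
      Polynomial.eval_C, Polynomial.eval_X]
    rw [← eval₂_id, coe_eval₂Hom]
    congr 1
    ext x
    simp
  have hcomplex : ∀ z : ℂ, Polynomial.aeval z (aeval L p) =
      aeval (fun i => (a i : ℂ) + v i * z) p := fun z => by
    rw [← AlgHom.comp_apply, comp_aeval]
    simp [L]
  have him : ∀ z : ℂ, Polynomial.aeval z (aeval L p) = 0 → z.im ≤ 0 := by
    intro z hz
    by_contra! h
    exact hp (fun i => (a i : ℂ) + v i * z)
      (fun i => by simpa using mul_pos (hv i) h) ((hcomplex z).symm.trans hz)
  have hpos : ∀ s : ℝ, 0 ≤ s → 0 < (aeval L p).eval s := fun s hs => by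
    rw [heval]
    exact ha (fun i => v i * s) fun i => mul_nonneg (hv i).le hs
  have hcoeff := coeff_nonneg_of_roots_neg _ (aeval L p) rfl (hpos 0 le_rfl) (fun z hz => by
    have h1 := him z hz
    have h2 := him (starRingEnd ℂ z) (by rw [Polynomial.aeval_conj, hz, map_zero])
    rw [Complex.conj_im] at h2
    have hzr : z = (z.re : ℂ) := Complex.ext rfl (by rw [Complex.ofReal_im]; linarith)
    refine ⟨z.re, ?_, hzr⟩
    by_contra! h
    have h3 := Polynomial.aeval_algebraMap_apply ℂ z.re (aeval L p)
    rw [Complex.coe_algebraMap, ← hzr, hz] at h3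
    exact (hpos z.re h).ne' (by simpa using h3.symm)) 2
  have hsecond : (Polynomial.derivative (Polynomial.derivative (aeval L p))).eval 0 =
      ∑ i, v i * ∑ j, v j * eval a (pderiv j (pderiv i p)) := by
    rw [derivative_aeval_eq_sum]
    simp [hL, derivative_aeval_eq_sum, Polynomial.eval_finsetSum, heval]
  rw [← hsecond, ← Polynomial.coeff_zero_eq_eval_zero, Polynomial.coeff_derivative,
    Polynomial.coeff_derivative]
  norm_num
  exact hcoeff

open MvPolynomial in
/-- At a point above the roots of a real stable polynomial, all pure second partial derivatives
are nonnegative. -/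
theorem RealStable.eval_pderiv_pderiv_nonneg {σ : Type*} [Fintype σ]
    {p : MvPolynomial σ ℝ} (hp : RealStable p) {a : σ → ℝ} (ha : AboveRoots p a) (k : σ) :
    0 ≤ eval a (pderiv k (pderiv k p)) := by
  classical
  let F : ℝ → ℝ := fun ε => ∑ i, ((Pi.single k 1 : σ → ℝ) i + ε) *
    ∑ j, ((Pi.single k 1 : σ → ℝ) j + ε) * eval a (pderiv j (pderiv i p))
  have hF : Continuous F := by fun_prop
  have hlim := (hF.tendsto 0).mono_left (nhdsWithin_le_nhds (s := Set.Ioi 0))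
  have h0 : F 0 = eval a (pderiv k (pderiv k p)) := by
    simp [F, Pi.single_apply]
  rw [← h0]
  refine ge_of_tendsto hlim ?_
  filter_upwards [self_mem_nhdsWithin] with ε hε
  refine hp.second_directional_deriv_nonneg_of_pos ha fun i => ?_
  rw [Set.mem_Ioi] at hε
  by_cases h : i = k
  · subst h; simp; linarith
  · simpa [h] using hε

open MvPolynomial in
/-- Partial derivatives of polynomials commute. -/
theorem pderiv_pderiv_comm_s16 {α R : Type*} [CommRing R] (i j : α) (p : MvPolynomial α R) :
    pderiv i (pderiv j p) = pderiv j (pderiv i p) := by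
  classical
  have h : ⁅(pderiv i : Derivation R (MvPolynomial α R) (MvPolynomial α R)), pderiv j⁆ = 0 :=
    derivation_ext fun k => by
      rw [Derivation.commutator_apply, Derivation.zero_apply, pderiv_X, pderiv_X]
      simp only [Pi.single_apply, apply_ite, map_zero, pderiv_one, ite_self, sub_self]
  have hp := congrArg (fun D => D p) h
  rwa [Derivation.commutator_apply, Derivation.zero_apply, sub_eq_zero] at hp

open MvPolynomial in
/-- Differentiating after identifying the variable `w` with `z`. -/
theorem pderiv_rename_identify {α : Type*} [DecidableEq α] {R : Type*} [CommRing R]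
    {z w : α} (hzw : z ≠ w) (p : MvPolynomial α R) :
    pderiv z (rename (fun v => if v = w then z else v) p) =
      rename (fun v => if v = w then z else v) (pderiv z p + pderiv w p) := by
  induction p using MvPolynomial.induction_on with
  | C a => simp
  | add p q hp hq =>
    simp only [map_add, hp, hq]
    ring
  | mul_X p j hp =>
    simp only [map_mul, map_add, rename_X, Derivation.leibniz, pderiv_X, smul_eq_mul] at hp ⊢
    rw [hp]
    by_cases hw : j = w
    · subst hw
      simp [hzw.symm]
      ring
    · by_cases hz : j = z
      · subst hz
        simp [hw]
        ring
      · simp [hw, hz]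
        ring

/-- comparison of the operators `1 − ½∂²_{z≡w}` and `1 − ∂_z∂_w`
(Lemma `qz`).  Variables: `x_j` is indexed by `Sum.inl j`, `z` by `Sum.inr false`
and `w` by `Sum.inr true`. -/
theorem statement16 {n : ℕ} (p : MvPolynomial (Fin n ⊕ Bool) ℝ) (hp : RealStable p)
    (t : Fin n → ℝ)
    (h0 : AboveRoots p (Sum.elim t fun _ => 0))
    (h1 : AboveRoots
      (MvPolynomial.aeval
        (Sum.elim (fun j => (MvPolynomial.X (Sum.inl j) : MvPolynomial (Fin n ⊕ Bool) ℝ))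
          (fun _ => 0))
        (MvPolynomial.rename
            (fun v => if v = Sum.inr true then Sum.inr false else v) p -
          (1 / 2 : ℝ) • MvPolynomial.pderiv (Sum.inr false)
            (MvPolynomial.pderiv (Sum.inr false)
              (MvPolynomial.rename
                (fun v => if v = Sum.inr true then Sum.inr false else v) p))))
      (Sum.elim t fun _ => 0)) :
    AboveRoots
      (MvPolynomial.aeval
        (Sum.elim (fun j => (MvPolynomial.X (Sum.inl j) : MvPolynomial (Fin n ⊕ Bool) ℝ))
          (fun _ => 0))
        (p - MvPolynomial.pderiv (Sum.inr false) (MvPolynomial.pderiv (Sum.inr true) p)))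
      (Sum.elim t fun _ => 0) := by
  have heval : ∀ (q : MvPolynomial (Fin n ⊕ Bool) ℝ) (u : Fin n ⊕ Bool → ℝ),
      MvPolynomial.eval ((Sum.elim t fun _ => 0) + u)
        (MvPolynomial.aeval
          (Sum.elim (fun j => (MvPolynomial.X (Sum.inl j) : MvPolynomial (Fin n ⊕ Bool) ℝ))
            (fun _ => 0)) q) =
      MvPolynomial.eval (Sum.elim (fun j => t j + u (Sum.inl j)) fun _ => 0) q := by
    intro q u
    induction q using MvPolynomial.induction_on with
    | C a => simp
    | add p q hp hq => simp only [map_add, hp, hq]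
    | mul_X p j hp =>
      simp only [map_mul, hp, MvPolynomial.aeval_X, MvPolynomial.eval_X]
      cases j <;> simp
  intro u hu
  have hlt := h1 u hu
  rw [heval] at hlt ⊢
  set y : Fin n ⊕ Bool → ℝ := Sum.elim (fun j => t j + u (Sum.inl j)) fun _ => 0 with hy
  have habove : AboveRoots p y := by
    intro s hs
    have h := h0 (Sum.elim (fun j => u (Sum.inl j)) (fun _ => 0) + s) fun i => by
      cases i
      · simpa using add_nonneg (hu _) (hs _)
      · simpa using hs _
    convert h using 2
    rw [← add_assoc]
    congr 1
    ext i
    cases i <;> simp [hy]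
  have hid : (y ∘ fun v => if v = Sum.inr true then Sum.inr false else v) = y := by
    ext i
    rcases i with j | _ | _ <;> simp [hy]
  have hne : (Sum.inr false : Fin n ⊕ Bool) ≠ Sum.inr true := by simp
  have hcomm : MvPolynomial.pderiv (Sum.inr true) (MvPolynomial.pderiv (Sum.inr false) p) =
      MvPolynomial.pderiv (Sum.inr false) (MvPolynomial.pderiv (Sum.inr true) p) :=
    pderiv_pderiv_comm_s16 _ _ _
  have hz := hp.eval_pderiv_pderiv_nonneg habove (Sum.inr false)
  have hw := hp.eval_pderiv_pderiv_nonneg habove (Sum.inr true)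
  rw [pderiv_rename_identify hne, pderiv_rename_identify hne, map_sub, MvPolynomial.smul_eval,
    MvPolynomial.eval_rename, MvPolynomial.eval_rename, hid] at hlt
  simp only [map_add, hcomm] at hlt
  rw [map_sub]
  linarith
end

section
/- Let B_1,…,B_m be d×d positive semidefinite matrices with tr(B_i) ≤ 1 for all i and Σ_{i=1}^m tr(B_i)·B_i ≤ I. Then the quadratic mixed characteristic polynomial μ₂[B_1,…,B_m] has all of its real roots at most 4; that is, every real root x of μ₂[B_1,…,B_m] satisfies x ≤ 4. -/
open scoped ComplexOrder

/-- The quadratic mixed characteristic polynomial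
`μ₂[B_1,…,B_m](x) = ∏ (1 − ∂_{z_i}∂_{w_i}) [det(x I + Σ z_i B_i)·det(x I + Σ w_i B_i)]`
evaluated at `z = w = 0`.  The variable `z_i` is indexed by `Sum.inl i` and `w_i` by
`Sum.inr i`. -/
noncomputable def quadMixedCharPoly {m d : ℕ} (B : Fin m → Matrix (Fin d) (Fin d) ℂ) :
    Polynomial ℂ :=
  MvPolynomial.eval (fun _ => (0 : Polynomial ℂ))
    ((List.ofFn fun i : Fin m =>
        ((1 : Module.End (Polynomial ℂ) (MvPolynomial (Fin m ⊕ Fin m) (Polynomial ℂ))) -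
          ((MvPolynomial.pderiv (Sum.inl i)).toLinearMap ∘ₗ
            (MvPolynomial.pderiv (Sum.inr i)).toLinearMap) :
          Module.End (Polynomial ℂ) (MvPolynomial (Fin m ⊕ Fin m) (Polynomial ℂ)))).prod
      (Matrix.det (Matrix.of fun a b =>
          MvPolynomial.C Polynomial.X * (if a = b then 1 else 0) +
            ∑ i, MvPolynomial.X (Sum.inl i) * MvPolynomial.C (Polynomial.C (B i a b))) *
       Matrix.det (Matrix.of fun a b =>
          MvPolynomial.C Polynomial.X * (if a = b then 1 else 0) +
            ∑ i, MvPolynomial.X (Sum.inr i) * MvPolynomial.C (Polynomial.C (B i a b)))))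

section

open Polynomial Filter Topology Matrix

/-- The negative of the second logarithmic derivative of a complex polynomial whose roots all lie
strictly to the left of and not above a real point has nonpositive imaginary part. -/
theorem Polynomial.im_neg_logDeriv_deriv_nonpos (q : ℂ[X]) (t : ℝ) (hq : q ≠ 0)
    (h : ∀ μ : ℂ, q.eval μ = 0 → μ.re < t ∧ μ.im ≤ 0) :
    (((derivative q).eval (t : ℂ) ^ 2 - q.eval (t : ℂ) * (derivative (derivative q)).eval (t : ℂ)) /
      q.eval (t : ℂ) ^ 2).im ≤ 0 := by
  have key : ∀ s : Multiset ℂ, (∀ μ ∈ s, μ.re < t ∧ μ.im ≤ 0) →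
      ((s.map fun μ => X - C μ).prod.eval (t : ℂ) ≠ 0) ∧
      (((derivative (s.map fun μ => X - C μ).prod).eval (t : ℂ) ^ 2 -
        (s.map fun μ => X - C μ).prod.eval (t : ℂ) *
        (derivative (derivative (s.map fun μ => X - C μ).prod)).eval (t : ℂ)) /
      (s.map fun μ => X - C μ).prod.eval (t : ℂ) ^ 2).im ≤ 0 := by
    intro s
    induction s using Multiset.induction with
    | empty => simp
    | cons μ s ih =>
      intro hs
      obtain ⟨h0, h1⟩ := ih fun ν hν => hs ν (Multiset.mem_cons_of_mem hν)
      obtain ⟨hre, him⟩ := hs μ (Multiset.mem_cons_self μ s)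
      have hne : (t : ℂ) - μ ≠ 0 := by
        intro h
        have := congrArg Complex.re h
        simp at this
        linarith
      rw [Multiset.map_cons, Multiset.prod_cons]
      generalize (s.map fun μ => X - C μ).prod = r at *
      refine ⟨by simpa using ⟨hne, h0⟩, ?_⟩
      have e : (((derivative ((X - C μ) * r)).eval (t : ℂ) ^ 2 - ((X - C μ) * r).eval (t : ℂ) *
          (derivative (derivative ((X - C μ) * r))).eval (t : ℂ)) /
          ((X - C μ) * r).eval (t : ℂ) ^ 2) = 1 / ((t : ℂ) - μ) ^ 2 +
          ((derivative r).eval (t : ℂ) ^ 2 - r.eval (t : ℂ) *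
          (derivative (derivative r)).eval (t : ℂ)) / r.eval (t : ℂ) ^ 2 := by
        simp only [derivative_mul, derivative_sub, derivative_X, derivative_C, derivative_add,
          eval_add, eval_mul, eval_sub, eval_X, eval_C, sub_zero, eval_one, derivative_one,
          eval_zero]
        field_simp
        ring
      rw [e, Complex.add_im]
      have : (1 / ((t : ℂ) - μ) ^ 2).im ≤ 0 := by
        rw [one_div, Complex.inv_im]
        apply div_nonpos_of_nonpos_of_nonneg _ (Complex.normSq_nonneg _)
        simp [pow_two]
        nlinarith
      linarith
  obtain ⟨h0, h1⟩ := key q.roots fun μ hμ => h μ ((mem_roots hq).1 hμ)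
  have e := (IsAlgClosed.splits q).eq_prod_roots
  generalize (q.roots.map fun μ => X - C μ).prod = r at *
  have hl : q.leadingCoeff ≠ 0 := by simpa using hq
  generalize q.leadingCoeff = a at *
  subst e
  convert h1 using 2
  simp only [derivative_C_mul, eval_mul, eval_C]
  field_simp

theorem Polynomial.im_logDeriv_neg (q : ℂ[X]) (h : ∀ μ : ℂ, 0 ≤ μ.im → q.eval μ ≠ 0)
    (hd : (derivative q).eval 0 ≠ 0) : ((derivative q).eval 0 / q.eval 0).im < 0 := by
  have h0 := h 0 (by simp)
  have hq : q ≠ 0 := by rintro rfl; simp at h0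
  have e := (IsAlgClosed.splits q).eval_derivative_div_eval_of_ne_zero h0
  have key : ∀ s : Multiset ℂ, (∀ μ ∈ s, μ.im < 0) →
      s = 0 ∨ ((s.map fun z : ℂ => 1 / (0 - z)).sum).im < 0 := by
    intro s
    induction s using Multiset.induction with
    | empty => simp
    | cons μ s ih =>
      intro hs
      right
      have hμ := hs μ (Multiset.mem_cons_self μ s)
      have : (1 / (0 - μ)).im < 0 := by
        have : 0 < Complex.normSq μ := by
          rw [Complex.normSq_pos]; rintro rfl; simp at hμ
        simp only [zero_sub, one_div, inv_neg, Complex.neg_im, Complex.inv_im]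
        rw [neg_div, neg_neg]
        exact div_neg_of_neg_of_pos hμ this
      rw [Multiset.map_cons, Multiset.sum_cons, Complex.add_im]
      rcases ih fun ν hν => hs ν (Multiset.mem_cons_of_mem hν) with rfl | h
      · simpa using this
      · linarith
  rw [e]
  rcases key q.roots fun μ hμ => by
    by_contra! hc
    exact h μ hc ((mem_roots hq).1 hμ) with h1 | h1
  · rw [h1] at e
    simp [hd, h0] at e
  · exact h1

/-- A polynomial without zeros in the closed upper half plane has a first-order Taylor expansion
without zeros there. -/
theorem Polynomial.eval_add_mul_derivative_ne_zero (q : ℂ[X])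
    (h : ∀ μ : ℂ, 0 ≤ μ.im → q.eval μ ≠ 0) {s : ℂ} (hs : 0 ≤ s.im) :
    q.eval 0 + s * (derivative q).eval 0 ≠ 0 := by
  intro hc
  have h0 := h 0 (by simp)
  have hd : (derivative q).eval 0 ≠ 0 := by
    intro h1
    rw [h1] at hc
    simp [h0] at hc
  have h2 := q.im_logDeriv_neg h hd
  have hs0 : s ≠ 0 := by rintro rfl; simp [h0] at hc
  have : (derivative q).eval 0 / q.eval 0 = - s⁻¹ := by
    field_simp
    linear_combination hc
  rw [this, Complex.neg_im, Complex.inv_im, neg_div, neg_neg] at h2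
  exact absurd h2 (not_lt.2 (div_nonneg hs (Complex.normSq_nonneg _)))

/-- The logarithmic derivative at zero of a polynomial whose roots have negative real part. -/
theorem Polynomial.derivative_eval_zero_nonneg (q : ℝ[X]) (h0 : 0 < q.eval 0)
    (h : ∀ μ : ℂ, aeval μ q = 0 → μ.re < 0) : 0 ≤ (derivative q).eval 0 := by
  set p : ℂ[X] := q.map (algebraMap ℝ ℂ) with hp
  have ev : ∀ r : ℝ[X], (r.map (algebraMap ℝ ℂ)).eval 0 = (r.eval 0 : ℝ) := by
    intro r
    rw [← Complex.ofReal_zero]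
    exact Polynomial.eval_map_algebraMap _ _ |>.trans (aeval_algebraMap_apply_eq_algebraMap_eval _ _)
  have p0 : p.eval 0 ≠ 0 := by rw [hp, ev]; exact_mod_cast h0.ne'
  have hpne : p ≠ 0 := by rintro h; rw [h] at p0; simp at p0
  have e := (IsAlgClosed.splits p).eval_derivative_div_eval_of_ne_zero p0
  have key : ∀ s : Multiset ℂ, (∀ μ ∈ s, μ.re < 0) →
      0 ≤ ((s.map fun z : ℂ => 1 / (0 - z)).sum).re := by
    intro s
    induction s using Multiset.induction with
    | empty => simp
    | cons μ s ih =>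
      intro hs
      have hμ := hs μ (Multiset.mem_cons_self μ s)
      have : 0 ≤ (1 / (0 - μ)).re := by
        simp only [zero_sub, one_div, inv_neg, Complex.neg_re, Complex.inv_re]
        rw [← neg_div]
        exact div_nonneg (by linarith) (Complex.normSq_nonneg _)
      rw [Multiset.map_cons, Multiset.sum_cons, Complex.add_re]
      linarith [ih fun ν hν => hs ν (Multiset.mem_cons_of_mem hν)]
  have h1 := key p.roots fun μ hμ => h μ (by
    have := (mem_roots hpne).1 hμ
    rwa [IsRoot, hp, eval_map_algebraMap] at this)
  rw [← e, hp, derivative_map, ev, ev, ← Complex.ofReal_div, Complex.ofReal_re] at h1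
  by_contra! hc
  exact absurd h1 (not_le.2 (div_neg_of_neg_of_pos hc h0))
theorem Polynomial.aeval_complexOfReal (q : ℝ[X]) (t : ℝ) : aeval (t : ℂ) q = (q.eval t : ℝ) :=
  aeval_algebraMap_apply_eq_algebraMap_eval _ _

theorem Polynomial.aeval_ne_zero_of_re_nonneg (A : ℝ[X]) (hA : ∀ t : ℝ, 0 ≤ t → 0 < A.eval t)
    (hst : ∀ z : ℂ, 0 < z.im → aeval z A ≠ 0) {z : ℂ} (hz : 0 ≤ z.re) : aeval z A ≠ 0 := by
  rcases lt_trichotomy z.im 0 with h | h | h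
  · intro hc
    apply hst (starRingEnd ℂ z) (by simpa using h)
    rw [aeval_conj, hc, map_zero]
  · have : z = (z.re : ℂ) := Complex.ext (by simp) (by simp [h])
    rw [this, aeval_complexOfReal]
    exact_mod_cast (hA _ hz).ne'
  · exact hst z h

theorem Polynomial.degree_le_of_abs_eval_le (A B : ℝ[X]) (hA : ∀ t : ℝ, 0 ≤ t → 0 < A.eval t)
    {K : ℝ} (hb : ∀ t : ℝ, 0 ≤ t → |B.eval t| ≤ K * A.eval t) : B.degree ≤ A.degree := by
  by_contra! hc
  have hA0 : A ≠ 0 := by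
    rintro rfl
    simpa using hA 0 le_rfl
  have h := B.abs_div_tendsto_atTop_atTop_of_degree_gt A hc hA0
  obtain ⟨t, ht, h0⟩ := ((h.eventually (eventually_gt_atTop K)).and (eventually_ge_atTop 0)).exists
  rw [abs_div, abs_of_pos (hA t h0), lt_div_iff₀ (hA t h0)] at ht
  exact absurd (hb t h0) (not_le.2 ht)

theorem Polynomial.exists_norm_aeval_le (A B : ℝ[X]) (hdeg : B.degree ≤ A.degree)
    (h : ∀ z : ℂ, 0 ≤ z.re → aeval z A ≠ 0) :
    ∃ K : ℝ, 0 < K ∧ ∀ z : ℂ, 0 ≤ z.re → ‖aeval z B‖ ≤ K * ‖aeval z A‖ := by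
  have hdeg' : (B.map (algebraMap ℝ ℂ)).degree ≤ (A.map (algebraMap ℝ ℂ)).degree := by
    simpa [degree_map] using hdeg
  have hO := isBigO_cobounded_of_degree_le hdeg'
  obtain ⟨C, hC⟩ := hO.bound
  obtain ⟨R, hR⟩ := (hasBasis_cobounded_norm (E := ℂ)).mem_iff.1 hC
  have hcomp : IsCompact (Metric.closedBall (0 : ℂ) R ∩ {z | 0 ≤ z.re}) :=
    (isCompact_closedBall _ _).inter_right (isClosed_le continuous_const Complex.continuous_re)
  have hcont : ContinuousOn (fun z : ℂ => aeval z B / aeval z A)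
      (Metric.closedBall (0 : ℂ) R ∩ {z | 0 ≤ z.re}) := by
    apply ContinuousOn.div
    · exact (Polynomial.continuous_aeval B).continuousOn
    · exact (Polynomial.continuous_aeval A).continuousOn
    · exact fun z hz => h z hz.2
  obtain ⟨D, hD⟩ := hcomp.exists_bound_of_continuousOn hcont
  refine ⟨max (max C D) 1, by positivity, fun z hz => ?_⟩
  by_cases hzR : R ≤ ‖z‖
  · have := hR.2 (show z ∈ {x : ℂ | R ≤ ‖x‖} from hzR)
    simp only [Set.mem_ofPred_eq, eval_map_algebraMap] at this
    refine this.trans ?_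
    gcongr
    exact (le_max_left _ _).trans (le_max_left _ _)
  · have := hD z ⟨by simpa using (not_le.1 hzR).le, hz⟩
    rw [norm_div, div_le_iff₀ (norm_pos_iff.2 (h z hz))] at this
    refine this.trans ?_
    gcongr
    exact (le_max_right _ _).trans (le_max_left _ _)

/-- The numerator of the second derivative of `B / A` is nonnegative when `A + i η B` has no zeros
in the upper half plane. -/
theorem Polynomial.second_derivative_div_nonneg (A B : ℝ[X])
    (hA : ∀ t : ℝ, 0 ≤ t → 0 < A.eval t)
    (hst : ∀ η : ℝ, 0 ≤ η → ∀ z : ℂ, 0 < z.im → aeval z A + (η * Complex.I) * aeval z B ≠ 0)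
    {K : ℝ} (hb : ∀ t : ℝ, 0 ≤ t → |B.eval t| ≤ K * A.eval t) {t : ℝ} (ht : 0 ≤ t) :
    0 ≤ A.eval t ^ 2 * (derivative (derivative B)).eval t
      - A.eval t * B.eval t * (derivative (derivative A)).eval t
      - 2 * A.eval t * (derivative A).eval t * (derivative B).eval t
      + 2 * B.eval t * (derivative A).eval t ^ 2 := by
  have hAz : ∀ z : ℂ, 0 ≤ z.re → aeval z A ≠ 0 := fun z hz =>
    A.aeval_ne_zero_of_re_nonneg hA (fun z hz => by simpa using hst 0 le_rfl z hz) hz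
  obtain ⟨M, hM0, hM⟩ := exists_norm_aeval_le A B (degree_le_of_abs_eval_le A B hA hb) hAz
  have hev : ∀ r : ℝ[X], (r.map (algebraMap ℝ ℂ)).eval (t : ℂ) = (r.eval t : ℝ) := fun r => by
    rw [eval_map_algebraMap, aeval_complexOfReal]
  set a := A.eval t
  set b := B.eval t
  set a₁ := (derivative A).eval t
  set b₁ := (derivative B).eval t
  set a₂ := (derivative (derivative A)).eval t
  set b₂ := (derivative (derivative B)).eval t
  have ha : 0 < a := hA t ht
  have key : ∀ η : ℝ, 0 < η → η < M⁻¹ →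
      0 ≤ (a₂ * b + b₂ * a - 2 * a₁ * b₁) * (a ^ 2 - η ^ 2 * b ^ 2)
        - 2 * a * b * (a₂ * a - a₁ ^ 2 - η ^ 2 * (b₂ * b - b₁ ^ 2)) := by
    intro η hη hηM
    set q : ℂ[X] := A.map (algebraMap ℝ ℂ) + C (η * Complex.I) * B.map (algebraMap ℝ ℂ) with hqdef
    have hqz : ∀ z : ℂ, q.eval z = aeval z A + (η * Complex.I) * aeval z B := fun z => by
      simp [hqdef, eval_map_algebraMap]
    have hre : ∀ z : ℂ, 0 ≤ z.re → q.eval z ≠ 0 := by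
      intro z hz hc
      rw [hqz] at hc
      have h1 : ‖aeval z A‖ = η * ‖aeval z B‖ := by
        rw [eq_neg_of_add_eq_zero_left hc, norm_neg, norm_mul, norm_mul]
        simp [abs_of_pos hη]
      have h2 := hM z hz
      have h3 : 0 < ‖aeval z A‖ := norm_pos_iff.2 (hAz z hz)
      have h4 : η * M < 1 := by
        calc η * M < M⁻¹ * M := by gcongr
          _ = 1 := inv_mul_cancel₀ hM0.ne'
      nlinarith
    have hqt : q.eval (t : ℂ) ≠ 0 := hre _ (by simpa using ht)
    have h := q.im_neg_logDeriv_deriv_nonpos t (by rintro h; simp [h] at hqt) (fun μ hμ => by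
      constructor
      · by_contra! hc
        exact hre μ (ht.trans hc) hμ
      · by_contra! hc
        exact hst η hη.le μ hc (by rw [← hqz, hμ]))
    have e0 : q.eval (t : ℂ) = a + η * Complex.I * b := by simp [hqdef, hev, a, b]
    have e1 : (derivative q).eval (t : ℂ) = a₁ + η * Complex.I * b₁ := by
      simp only [hqdef, derivative_add, derivative_C_mul, derivative_map, eval_add, eval_mul,
        eval_C, hev, a₁, b₁]
    have e2 : (derivative (derivative q)).eval (t : ℂ) = a₂ + η * Complex.I * b₂ := by
      simp only [hqdef, derivative_add, derivative_C_mul, derivative_map, eval_add, eval_mul,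
        eval_C, hev, a₂, b₂]
    rw [e0] at hqt
    rw [e0, e1, e2, Complex.div_im, ← sub_div] at h
    have hn : 0 < Complex.normSq ((a + η * Complex.I * b) ^ 2) :=
      Complex.normSq_pos.2 (pow_ne_zero 2 hqt)
    have h5 := (div_le_iff₀ hn).1 h
    simp [pow_two] at h5
    have h6 : 0 ≤ η * ((a₂ * b + b₂ * a - 2 * a₁ * b₁) * (a ^ 2 - η ^ 2 * b ^ 2)
        - 2 * a * b * (a₂ * a - a₁ ^ 2 - η ^ 2 * (b₂ * b - b₁ ^ 2))) := by
      linear_combination h5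
    exact nonneg_of_mul_nonneg_right h6 hη
  have hlim : Tendsto (fun η : ℝ => (a₂ * b + b₂ * a - 2 * a₁ * b₁) * (a ^ 2 - η ^ 2 * b ^ 2)
        - 2 * a * b * (a₂ * a - a₁ ^ 2 - η ^ 2 * (b₂ * b - b₁ ^ 2))) (𝓝[>] 0)
      (𝓝 ((a₂ * b + b₂ * a - 2 * a₁ * b₁) * (a ^ 2 - 0 ^ 2 * b ^ 2)
        - 2 * a * b * (a₂ * a - a₁ ^ 2 - 0 ^ 2 * (b₂ * b - b₁ ^ 2)))) := by
    apply Tendsto.mono_left _ nhdsWithin_le_nhds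
    apply Continuous.tendsto
    fun_prop
  have h := ge_of_tendsto hlim (by
    filter_upwards [Ioo_mem_nhdsGT (inv_pos.2 hM0)] with η hη using key η hη.1 hη.2)
  have h7 : 0 ≤ a * (a ^ 2 * b₂ - a * b * a₂ - 2 * a * a₁ * b₁ + 2 * b * a₁ ^ 2) := by
    linear_combination h
  exact nonneg_of_mul_nonneg_right h7 ha

/-- A tangent line inequality for `B / A`. -/
theorem Polynomial.div_tangent_le (A B : ℝ[X])
    (hA : ∀ t : ℝ, 0 ≤ t → 0 < A.eval t)
    (hst : ∀ η : ℝ, 0 ≤ η → ∀ z : ℂ, 0 < z.im → aeval z A + (η * Complex.I) * aeval z B ≠ 0)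
    {K : ℝ} (hb : ∀ t : ℝ, 0 ≤ t → |B.eval t| ≤ K * A.eval t) :
    B.eval 1 / A.eval 1 + (B.eval 1 * (derivative A).eval 1 - (derivative B).eval 1 * A.eval 1) /
      A.eval 1 ^ 2 ≤ B.eval 0 / A.eval 0 := by
  have d1 : ∀ x : ℝ, 0 ≤ x → HasDerivAt (fun t => B.eval t / A.eval t)
      (((derivative B).eval x * A.eval x - B.eval x * (derivative A).eval x) / A.eval x ^ 2) x :=
    fun x hx => (B.hasDerivAt x).div (A.hasDerivAt x) (hA x hx).ne'
  have hconv : ConvexOn ℝ (Set.Ici 0) (fun t => B.eval t / A.eval t) := by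
    refine convexOn_of_hasDerivWithinAt2_nonneg (convex_Ici 0)
      (f' := fun x => ((derivative B).eval x * A.eval x - B.eval x * (derivative A).eval x) /
        A.eval x ^ 2)
      (f'' := fun x => (((derivative (derivative B)).eval x * A.eval x +
          (derivative B).eval x * (derivative A).eval x -
          ((derivative B).eval x * (derivative A).eval x +
          B.eval x * (derivative (derivative A)).eval x)) * A.eval x ^ 2 -
          ((derivative B).eval x * A.eval x - B.eval x * (derivative A).eval x) *
          (2 * A.eval x * (derivative A).eval x)) / (A.eval x ^ 2) ^ 2)
      ?_ ?_ ?_ ?_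
    · exact fun x hx => (d1 x hx).continuousAt.continuousWithinAt
    · intro x hx
      rw [interior_Ici] at hx
      exact (d1 x hx.le).hasDerivWithinAt
    · intro x hx
      rw [interior_Ici] at hx
      refine HasDerivAt.hasDerivWithinAt ?_
      have h2 : HasDerivAt (fun t => A.eval t ^ 2) (2 * A.eval x * (derivative A).eval x) x := by
        simpa using (A.hasDerivAt x).fun_pow 2
      exact ((((derivative B).hasDerivAt x).mul (A.hasDerivAt x)).sub
        ((B.hasDerivAt x).mul ((derivative A).hasDerivAt x))).div h2
        (pow_ne_zero 2 (hA x hx.le).ne')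
    · intro x hx
      rw [interior_Ici] at hx
      apply div_nonneg _ (by positivity)
      have := mul_nonneg (hA x hx.le).le (second_derivative_div_nonneg A B hA hst hb hx.le)
      linear_combination this
  have h := hconv.slope_le_of_hasDerivAt (x := 0) (y := 1) (by simp) (by simp) one_pos
    (d1 1 zero_le_one)
  rw [slope_def_field, sub_zero, div_one, sub_div] at h
  rw [sub_div]
  linarith [mul_comm (B.eval 1) ((derivative A).eval 1)]

namespace MvPolynomial

variable {σ : Type*} [Fintype σ] [DecidableEq σ]

/-- The restriction of a multivariate polynomial to the line through `z` with direction `e`. -/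
noncomputable def restrictLine {S : Type*} [CommRing S] (z e : σ → S) :
    MvPolynomial σ S →ₐ[S] S[X] :=
  aeval fun j => Polynomial.C (z j) + Polynomial.C (e j) * Polynomial.X

omit [Fintype σ] [DecidableEq σ] in
theorem eval_restrictLine {S : Type*} [CommRing S] (z e : σ → S) (P : MvPolynomial σ S) (t : S) :
    (restrictLine z e P).eval t = eval (fun j => z j + e j * t) P := by
  induction P using MvPolynomial.induction_on with
  | C a => simp [restrictLine]
  | add p q hp hq => simp [hp, hq]
  | mul_X p j hp =>
    rw [map_mul, Polynomial.eval_mul, hp]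
    simp [restrictLine]

theorem derivative_restrictLine {S : Type*} [CommRing S] (z e : σ → S) (P : MvPolynomial σ S) :
    Polynomial.derivative (restrictLine z e P) =
      ∑ j, Polynomial.C (e j) * restrictLine z e (pderiv j P) := by
  induction P using MvPolynomial.induction_on with
  | C a => simp [restrictLine]
  | add p q hp hq => simp [hp, hq, mul_add, Finset.sum_add_distrib]
  | mul_X p i hp =>
    have h1 : Polynomial.derivative (restrictLine z e (X i)) = Polynomial.C (e i) := by
      simp [restrictLine]
    simp only [map_mul, Polynomial.derivative_mul, hp, h1, Derivation.leibniz, smul_eq_mul,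
      map_add, mul_add, Finset.sum_add_distrib, pderiv_X, Finset.sum_mul]
    rw [add_comm]
    congr 1
    · rw [Finset.sum_eq_single i]
      · simp [mul_comm]
      · intro j _ hj
        simp [hj.symm]
      · simp
    · exact Finset.sum_congr rfl fun j _ => by ring

omit [Fintype σ] in
theorem pderiv_comm {S : Type*} [CommRing S] (i j : σ) (P : MvPolynomial σ S) :
    pderiv i (pderiv j P) = pderiv j (pderiv i P) := by
  have h : ⁅(pderiv i : Derivation S (MvPolynomial σ S) (MvPolynomial σ S)),
      (pderiv j : Derivation S (MvPolynomial σ S) (MvPolynomial σ S))⁆ = 0 := by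
    apply derivation_ext
    intro k
    rw [Derivation.commutator_apply]
    simp [pderiv_X, Pi.single_apply, apply_ite]
  have := Derivation.congr_fun h P
  rwa [Derivation.commutator_apply, Derivation.zero_apply, sub_eq_zero] at this

/-- A complex polynomial is upper stable when it has no zeros in the product of open upper half
planes. -/
def UpperStable (P : MvPolynomial σ ℂ) : Prop :=
  ∀ z : σ → ℂ, (∀ j, 0 < (z j).im) → eval z P ≠ 0

theorem UpperStable.add_mul_pderiv {P : MvPolynomial σ ℂ} (hP : UpperStable P) {s : ℂ}
    (hs : 0 ≤ s.im) (k : σ) : UpperStable (P + C s * pderiv k P) := by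
  intro z hz
  set q := restrictLine z (Pi.single k 1) P with hq
  have h0 : ∀ Q, (restrictLine z (Pi.single k 1) Q).eval 0 = eval z Q := fun Q => by
    simp [eval_restrictLine]
  have h1 : (Polynomial.derivative q).eval 0 = eval z (pderiv k P) := by
    rw [hq, derivative_restrictLine, Polynomial.eval_finsetSum, Finset.sum_eq_single k]
    · simp [h0]
    · intro j _ hj
      simp [hj]
    · simp
  have := q.eval_add_mul_derivative_ne_zero (s := s) (fun μ hμ => by
    rw [hq, eval_restrictLine]
    apply hP
    intro j
    by_cases hj : j = k
    · subst hj
      simpa using add_pos_of_pos_of_nonneg (hz j) hμ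
    · simpa [Pi.single_apply, hj] using hz j) hs
  rw [h1, hq, h0] at this
  simpa using this

theorem UpperStable.sub_pderiv_pderiv {P : MvPolynomial σ ℂ} (hP : UpperStable P) (i j : σ) :
    UpperStable (P - pderiv i (pderiv j P)) := by
  intro z hz hc
  have hA : eval z P ≠ 0 := hP z hz
  have key : ∀ s : ℂ, 0 ≤ s.im → eval z P + s * (eval z (pderiv i P) + eval z (pderiv j P)) +
      s ^ 2 * eval z (pderiv i (pderiv j P)) ≠ 0 := by
    intro s hs
    have := (hP.add_mul_pderiv hs j).add_mul_pderiv hs i z hz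
    convert this using 1
    simp [Derivation.leibniz]
    ring
  rw [map_sub, sub_eq_zero] at hc
  rw [← hc] at key
  set a := eval z P
  set b := eval z (pderiv i P) + eval z (pderiv j P)
  obtain ⟨r, hr⟩ := IsAlgClosed.exists_root
    (Polynomial.C a * Polynomial.X ^ 2 + Polynomial.C b * Polynomial.X + Polynomial.C a)
    (by rw [Polynomial.degree_quadratic hA]; norm_num)
  simp only [Polynomial.IsRoot, Polynomial.eval_add, Polynomial.eval_mul, Polynomial.eval_C,
    Polynomial.eval_pow, Polynomial.eval_X] at hr
  have hr0 : r ≠ 0 := by rintro rfl; simp [hA] at hr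
  rcases le_total 0 r.im with h | h
  · exact key r h (by linear_combination hr)
  · apply key r⁻¹
    · rw [Complex.inv_im]
      exact div_nonneg (by linarith) (Complex.normSq_nonneg _)
    · field_simp
      linear_combination hr

/-- A real polynomial is real stable when it has no zeros in the product of open upper half
planes. -/
def RealStable (P : MvPolynomial σ ℝ) : Prop := UpperStable (map (algebraMap ℝ ℂ) P)

theorem RealStable.add_mul_pderiv {P : MvPolynomial σ ℝ} (hP : RealStable P) (s : ℝ) (k : σ) :
    RealStable (P + C s * pderiv k P) := by
  have := UpperStable.add_mul_pderiv hP (s := (s : ℂ)) (by simp) k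
  unfold RealStable
  simpa [pderiv_map] using this

theorem RealStable.sub_pderiv_pderiv {P : MvPolynomial σ ℝ} (hP : RealStable P) (i j : σ) :
    RealStable (P - pderiv i (pderiv j P)) := by
  have := UpperStable.sub_pderiv_pderiv hP i j
  unfold RealStable
  simpa [pderiv_map] using this

omit [Fintype σ] [DecidableEq σ] in
theorem eval_map_ofReal (P : MvPolynomial σ ℝ) (u : σ → ℝ) :
    eval (fun j => (u j : ℂ)) (map (algebraMap ℝ ℂ) P) = (eval u P : ℝ) := by
  rw [eval_map]
  exact (eval₂_comp (algebraMap ℝ ℂ) u P).symm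

/-- Real stable polynomials satisfy the strong Rayleigh inequalities. -/
theorem RealStable.rayleigh {P : MvPolynomial σ ℝ} (hP : RealStable P) (i j : σ) (u : σ → ℝ) :
    eval u P * eval u (pderiv i (pderiv j P)) ≤ eval u (pderiv i P) * eval u (pderiv j P) := by
  by_contra! hc
  let z : ℝ → σ → ℂ := fun δ l => u l + δ * Complex.I
  let E : MvPolynomial σ ℝ → ℝ → ℂ := fun Q δ => eval (z δ) (map (algebraMap ℝ ℂ) Q)
  have hE : ∀ Q, Tendsto (E Q) (𝓝[>] 0) (𝓝 ((eval u Q : ℝ) : ℂ)) := by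
    intro Q
    have h1 : Continuous (E Q) := (continuous_eval _).comp (by fun_prop)
    have h2 : E Q 0 = (eval u Q : ℝ) := by
      rw [← eval_map_ofReal]
      simp [E, z]
    rw [← h2]
    exact h1.continuousAt.tendsto.mono_left nhdsWithin_le_nhds
  set a := eval u P
  set b := eval u (pderiv i P)
  set c := eval u (pderiv j P)
  set d := eval u (pderiv i (pderiv j P))
  have hcd : (c : ℂ) + Complex.I * d ≠ 0 := by
    intro h
    have h1 := congrArg Complex.re h
    have h2 := congrArg Complex.im h
    simp at h1 h2
    simp [h1, h2] at hc
  have hden := (hE (pderiv j P)).add ((hE (pderiv i (pderiv j P))).const_mul Complex.I)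
  have hnum := (hE P).add ((hE (pderiv i P)).const_mul Complex.I)
  have hq := (hnum.div hden hcd).neg
  have him : 0 < (-(((a : ℂ) + Complex.I * b) / ((c : ℂ) + Complex.I * d))).im := by
    rw [Complex.neg_im, Complex.div_im, ← sub_div, ← neg_div]
    apply div_pos _ (Complex.normSq_pos.2 hcd)
    simp
    linarith
  have ev1 := ((Complex.continuous_im.tendsto _).comp hq).eventually (lt_mem_nhds him)
  have ev2 := hden.eventually_ne hcd
  obtain ⟨δ, ⟨h1, h2⟩, hδ⟩ := ((ev1.and ev2).and self_mem_nhdsWithin).exists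
  have hz : ∀ l, 0 < (z δ l).im := fun l => by simpa [z] using hδ
  set s : ℂ := -((E P δ + Complex.I * E (pderiv i P) δ) /
    (E (pderiv j P) δ + Complex.I * E (pderiv i (pderiv j P)) δ)) with hs
  have := (UpperStable.add_mul_pderiv hP (s := s) (le_of_lt h1) j).add_mul_pderiv
    (s := Complex.I) (by simp) i _ hz
  apply this
  have e : eval (z δ) (map (algebraMap ℝ ℂ) P + C s * pderiv j (map (algebraMap ℝ ℂ) P) +
      C Complex.I * pderiv i (map (algebraMap ℝ ℂ) P + C s * pderiv j (map (algebraMap ℝ ℂ) P))) =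
      (E P δ + Complex.I * E (pderiv i P) δ) +
      s * (E (pderiv j P) δ + Complex.I * E (pderiv i (pderiv j P)) δ) := by
    simp [E, Derivation.leibniz, pderiv_map]
    ring
  rw [e, hs, neg_mul, div_mul_cancel₀ _ h2, add_neg_cancel]

omit [Fintype σ] [DecidableEq σ] in
theorem aeval_restrictLine (z e : σ → ℝ) (P : MvPolynomial σ ℝ) (t : ℂ) :
    Polynomial.aeval t (restrictLine z e P) =
      eval (fun j => (z j : ℂ) + e j * t) (map (algebraMap ℝ ℂ) P) := by
  induction P using MvPolynomial.induction_on with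
  | C a => simp [restrictLine]
  | add p q hp hq => simp [hp, hq]
  | mul_X p j hp =>
    rw [map_mul, map_mul, hp]
    simp [restrictLine]

theorem eval_derivative_restrictLine {S : Type*} [CommRing S] (z e : σ → S) (P : MvPolynomial σ S)
    (t : S) : (Polynomial.derivative (restrictLine z e P)).eval t =
      ∑ j, e j * eval (fun i => z i + e i * t) (pderiv j P) := by
  simp [derivative_restrictLine, Polynomial.eval_finsetSum, eval_restrictLine]

/-- Positivity of a real polynomial on the orthant above a point. -/
def PositiveAbove (P : MvPolynomial σ ℝ) (v : σ → ℝ) : Prop :=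
  ∀ u, v ≤ u → 0 < eval u P

omit [Fintype σ] [DecidableEq σ] in
theorem PositiveAbove.mono {P : MvPolynomial σ ℝ} {u v : σ → ℝ} (h : PositiveAbove P v)
    (huv : v ≤ u) : PositiveAbove P u :=
  fun w hw => h w (huv.trans hw)

theorem nonneg_of_continuousAt_zero {f : ℝ → ℝ} (hf : ContinuousAt f 0)
    (h : ∀ δ, 0 < δ → 0 ≤ f δ) : 0 ≤ f 0 :=
  ge_of_tendsto (hf.tendsto.mono_left nhdsWithin_le_nhds : Tendsto f (𝓝[>] 0) _)
    (eventually_nhdsWithin_of_forall h)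

theorem nonneg_of_forall_add_mul_nonneg {a b : ℝ} (h : ∀ y, 0 ≤ y → 0 ≤ a + y * b) : 0 ≤ b := by
  by_contra! hb
  have ha := h 0 le_rfl
  rw [zero_mul, add_zero] at ha
  have := h ((a + 1) / -b) (div_nonneg (by linarith) (by linarith))
  rw [div_neg, neg_mul, div_mul_cancel₀ _ hb.ne] at this
  linarith

theorem RealStable.pderiv_nonneg {P : MvPolynomial σ ℝ} (hP : RealStable P) {v : σ → ℝ}
    (hv : PositiveAbove P v) (k : σ) : 0 ≤ eval v (pderiv k P) := by
  have hpos : ∀ e : σ → ℝ, (∀ j, 0 < e j) → 0 ≤ ∑ j, e j * eval v (pderiv j P) := by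
    intro e he
    set q := restrictLine v e P with hq
    have hA : ∀ t : ℝ, 0 ≤ t → 0 < q.eval t := fun t ht => by
      rw [hq, eval_restrictLine]
      exact hv _ fun j => le_add_of_nonneg_right (mul_nonneg (he j).le ht)
    have hst : ∀ z : ℂ, 0 < z.im → Polynomial.aeval z q ≠ 0 := fun z hz => by
      rw [hq, aeval_restrictLine]
      exact hP _ fun j => by simpa using mul_pos (he j) hz
    have := q.derivative_eval_zero_nonneg (hA 0 le_rfl) fun μ hμ => by
      by_contra! hre
      exact q.aeval_ne_zero_of_re_nonneg hA hst hre hμ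
    simpa [hq, eval_derivative_restrictLine] using this
  have h := nonneg_of_continuousAt_zero
    (f := fun δ => ∑ j, ((Pi.single k 1 : σ → ℝ) j + δ) * eval v (pderiv j P))
    (by fun_prop) fun δ hδ => hpos _ fun j => by
      by_cases hj : j = k
      · subst hj
        simpa using by linarith
      · simpa [hj] using hδ
  simpa [Pi.single_apply] using h

theorem RealStable.positiveAbove_add_mul_pderiv {P : MvPolynomial σ ℝ} (hP : RealStable P)
    {v : σ → ℝ} (hv : PositiveAbove P v) {y : ℝ} (hy : 0 ≤ y) (k : σ) :
    PositiveAbove (P + C y * pderiv k P) v := fun u hu => by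
  simpa using add_pos_of_pos_of_nonneg (hv u hu)
    (mul_nonneg hy (hP.pderiv_nonneg (hv.mono hu) k))

theorem RealStable.pderiv_pderiv_nonneg {P : MvPolynomial σ ℝ} (hP : RealStable P) {v : σ → ℝ}
    (hv : PositiveAbove P v) (i j : σ) : 0 ≤ eval v (pderiv i (pderiv j P)) := by
  refine nonneg_of_forall_add_mul_nonneg (a := eval v (pderiv i P)) fun y hy => ?_
  simpa using (hP.add_mul_pderiv y j).pderiv_nonneg (hP.positiveAbove_add_mul_pderiv hv hy j) i

theorem RealStable.pderiv_pderiv_pderiv_nonneg {P : MvPolynomial σ ℝ} (hP : RealStable P)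
    {v : σ → ℝ} (hv : PositiveAbove P v) (i j k : σ) :
    0 ≤ eval v (pderiv i (pderiv j (pderiv k P))) := by
  refine nonneg_of_forall_add_mul_nonneg (a := eval v (pderiv i (pderiv j P))) fun y hy => ?_
  simpa using
    (hP.add_mul_pderiv y k).pderiv_pderiv_nonneg (hP.positiveAbove_add_mul_pderiv hv hy k) i j

/-- The barrier functions `∂ₖP / P` of a real stable polynomial are nonincreasing. -/
theorem RealStable.pderiv_div_le {P : MvPolynomial σ ℝ} (hP : RealStable P) {u v : σ → ℝ}
    (hv : PositiveAbove P v) (huv : v ≤ u) (k : σ) :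
    eval u (pderiv k P) / eval u P ≤ eval v (pderiv k P) / eval v P := by
  set e := u - v with he
  have hA : ∀ t ∈ Set.Ici (0 : ℝ), 0 < (restrictLine v e P).eval t := fun t ht => by
    rw [eval_restrictLine]
    exact hv _ fun j => le_add_of_nonneg_right (mul_nonneg (sub_nonneg.2 (huv j)) ht)
  have hd : ∀ t ∈ Set.Ici (0 : ℝ), HasDerivAt
      (fun t => (restrictLine v e (pderiv k P)).eval t / (restrictLine v e P).eval t) _ t :=
    fun t ht => ((restrictLine v e (pderiv k P)).hasDerivAt t).fun_div
      ((restrictLine v e P).hasDerivAt t) (hA t ht).ne'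
  have hanti : AntitoneOn
      (fun t => (restrictLine v e (pderiv k P)).eval t / (restrictLine v e P).eval t)
      (Set.Ici 0) := by
    refine antitoneOn_of_hasDerivWithinAt_nonpos (convex_Ici 0)
      (fun t ht => (hd t ht).continuousAt.continuousWithinAt)
      (fun t ht => (hd t (interior_subset ht)).hasDerivWithinAt) fun t ht => ?_
    refine div_nonpos_of_nonpos_of_nonneg ?_ (sq_nonneg _)
    simp only [eval_derivative_restrictLine, eval_restrictLine]
    rw [Finset.sum_mul, Finset.mul_sum, ← Finset.sum_sub_distrib]
    refine Finset.sum_nonpos fun j _ => ?_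
    have h1 := hP.rayleigh j k fun i => v i + e i * t
    have h2 : 0 ≤ e j := sub_nonneg.2 (huv j)
    nlinarith
  have h := hanti (Set.mem_Ici.2 le_rfl) (Set.mem_Ici.2 zero_le_one) zero_le_one
  simpa [eval_restrictLine, he] using h

/-- The barrier functions `∂ₖP / P` of a real stable polynomial lie above their tangents in
nonnegative directions. -/
theorem RealStable.pderiv_div_tangent_le {P : MvPolynomial σ ℝ} (hP : RealStable P)
    {u v : σ → ℝ} (hv : PositiveAbove P v) (huv : v ≤ u) (k : σ) :
    eval u (pderiv k P) / eval u P +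
      (∑ j, (u j - v j) * (eval u (pderiv k P) * eval u (pderiv j P) -
        eval u (pderiv j (pderiv k P)) * eval u P)) / eval u P ^ 2 ≤
      eval v (pderiv k P) / eval v P := by
  have hstrict : ∀ e : σ → ℝ, (∀ j, 0 < e j) →
      eval (v + e) (pderiv k P) / eval (v + e) P +
      (∑ j, e j * (eval (v + e) (pderiv k P) * eval (v + e) (pderiv j P) -
        eval (v + e) (pderiv j (pderiv k P)) * eval (v + e) P)) / eval (v + e) P ^ 2 ≤
      eval v (pderiv k P) / eval v P := by
    intro e he
    have hle : ∀ t : ℝ, 0 ≤ t → v ≤ fun j => v j + e j * t := fun t ht j =>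
      le_add_of_nonneg_right (mul_nonneg (he j).le ht)
    have h := Polynomial.div_tangent_le (restrictLine v e P) (restrictLine v e (pderiv k P))
      (fun t ht => by
        rw [eval_restrictLine]
        exact hv _ (hle t ht))
      (fun η hη z hz => by
        have := UpperStable.add_mul_pderiv hP (s := η * Complex.I) (by simpa using hη) k
          (fun j => (v j : ℂ) + e j * z) fun j => by simpa using mul_pos (he j) hz
        rw [aeval_restrictLine, aeval_restrictLine]
        simpa [pderiv_map] using this)
      (K := eval v (pderiv k P) / eval v P)
      (fun t ht => by
        rw [eval_restrictLine, eval_restrictLine,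
          abs_of_nonneg (hP.pderiv_nonneg (hv.mono (hle t ht)) k)]
        exact (div_le_iff₀ (hv _ (hle t ht))).1 (hP.pderiv_div_le hv (hle t ht) k))
    have e0 : (fun j => v j + e j * 0) = v := by simp
    have e1 : (fun j => v j + e j * 1) = v + e := by ext; simp
    simp only [eval_derivative_restrictLine, eval_restrictLine, e0, e1] at h
    rw [Finset.mul_sum, Finset.sum_mul, ← Finset.sum_sub_distrib] at h
    convert h using 5
    ring
  have hc : ∀ Q : MvPolynomial σ ℝ, Continuous fun δ : ℝ => eval (u + fun _ => δ) Q := fun Q =>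
    (continuous_eval Q).comp (by fun_prop)
  have e3 : (u + fun _ => (0 : ℝ)) = u := by ext; simp
  have h0 : eval (u + fun _ => (0 : ℝ)) P ≠ 0 := by
    rw [e3]
    exact (hv u huv).ne'
  have h := nonneg_of_continuousAt_zero
    (f := fun δ => eval v (pderiv k P) / eval v P -
      (eval (u + fun _ => δ) (pderiv k P) / eval (u + fun _ => δ) P +
      (∑ j, (u j - v j + δ) * (eval (u + fun _ => δ) (pderiv k P) *
        eval (u + fun _ => δ) (pderiv j P) -
        eval (u + fun _ => δ) (pderiv j (pderiv k P)) * eval (u + fun _ => δ) P)) /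
        eval (u + fun _ => δ) P ^ 2))
    (by
      refine continuousAt_const.sub (((hc _).continuousAt.div (hc _).continuousAt h0).add
        (ContinuousAt.div (Continuous.continuousAt ?_) ((hc _).pow 2).continuousAt
          (pow_ne_zero 2 h0)))
      exact continuous_finsetSum _ fun j _ => (by fun_prop : Continuous fun δ => u j - v j + δ).mul
        (((hc _).mul (hc _)).sub ((hc _).mul (hc _))))
    fun δ hδ => by
      have e2 : (v + fun j => u j - v j + δ) = u + fun _ => δ := by
        ext j
        simp
        ring
      have := hstrict (fun j => u j - v j + δ) fun j => by linarith [huv j]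
      rw [e2] at this
      exact sub_nonneg.2 this
  simp only [e3, add_zero] at h
  exact sub_nonneg.1 h

theorem sub_le_mul_one_sub_of_rayleigh {B C D a B' C' D' φ c K : ℝ} (hB : 0 ≤ B)
    (hD : 0 ≤ D) (ha : 0 ≤ a) (hD' : 0 ≤ D') (hBφ : B ≤ φ) (hCφ : C ≤ φ) (hφ : φ < 1)
    (hc : 2 * φ ≤ c * (1 - φ ^ 2)) (hb : 0 ≤ a * B - B') (hb' : 0 ≤ a * C - C')
    (hray : ∀ y, (1 + y * a) * (D + y * D') ≤ (B + y * B') * (C + y * C'))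
    (hK : a + c * ((a * B - B') + (a * C - C')) ≤ K) : a - D' ≤ K * (1 - D) := by
  have hφ0 : 0 ≤ φ := hB.trans hBφ
  have hφ2 : 0 < 1 - φ ^ 2 := by nlinarith
  have hc0 : 0 ≤ c := by
    by_contra! h
    nlinarith [mul_pos_of_neg_of_neg h (neg_neg_of_pos hφ2)]
  have hBC : B * C ≤ φ ^ 2 := by nlinarith
  have hD1 : D ≤ φ ^ 2 := by simpa using (hray 0).trans (by simpa using hBC)
  set b := a * B - B' with hbdef
  set b' := a * C - C' with hbdef'
  have hS : 0 ≤ b + b' := add_nonneg hb hb'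
  have hK0 : 0 ≤ K := (add_nonneg ha (mul_nonneg hc0 hS)).trans hK
  rcases ha.eq_or_lt with rfl | ha
  · nlinarith [mul_nonneg hK0 (by linarith : 0 ≤ 1 - D)]
  have hR : ∀ R, 0 < R → R * (a * D - D') ≤ φ ^ 2 * R ^ 2 + φ * (b + b') * R + b * b' := by
    intro R hR
    have hne : R + a ≠ 0 := by positivity
    have h := mul_le_mul_of_nonneg_left (hray (-1 / (R + a))) (sq_nonneg (R + a))
    have e1 : (R + a) ^ 2 * ((1 + -1 / (R + a) * a) * (D + -1 / (R + a) * D')) =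
        R * (R * D + (a * D - D')) := by
      field_simp
      ring
    have e2 : (R + a) ^ 2 * ((B + -1 / (R + a) * B') * (C + -1 / (R + a) * C')) =
        (R * B + b) * (R * C + b') := by
      rw [hbdef, hbdef']
      field_simp
      ring
    rw [e1, e2] at h
    nlinarith [mul_nonneg (sq_nonneg R) hD, mul_le_mul_of_nonneg_left hBC (sq_nonneg R),
      mul_le_mul_of_nonneg_left hBφ (mul_nonneg hR.le hb'),
      mul_le_mul_of_nonneg_left hCφ (mul_nonneg hR.le hb)]
  have hF : a * D - D' ≤ 2 * φ * (b + b') := by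
    by_contra! hF
    set G := a * D - D' - φ * (b + b') with hG
    have hφS : 0 ≤ φ * (b + b') := mul_nonneg hφ0 hS
    have hGpos : φ * (b + b') < G := by linarith
    have hdisc : discrim (φ ^ 2) (-G) (b * b') ≤ 0 := discrim_le_zero fun R => by
      rcases lt_or_ge 0 R with h | h
      · have := hR R h
        nlinarith
      · nlinarith [mul_nonneg (sq_nonneg φ) (mul_self_nonneg R), mul_nonneg hb hb',
          mul_nonneg (hφS.trans hGpos.le) (neg_nonneg.2 h)]
    rw [discrim] at hdisc
    nlinarith [mul_nonneg (sq_nonneg φ) (sq_nonneg (b - b')), mul_self_lt_mul_self hφS hGpos]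
  nlinarith [mul_le_mul_of_nonneg_right hK (by linarith : 0 ≤ 1 - D),
    mul_le_mul_of_nonneg_right hc hS,
    mul_le_mul_of_nonneg_left hD1 (mul_nonneg hc0 hS)]

/-- The barrier argument for the operator `1 - ∂ᵢ∂ⱼ`: moving by `c` in the directions `i` and `j`
preserves positivity and does not increase the barrier functions. -/
theorem RealStable.barrier_sub_pderiv_pderiv {P : MvPolynomial σ ℝ} (hP : RealStable P)
    {u v : σ → ℝ} (hv : PositiveAbove P v) {i j : σ} {φ c : ℝ} (hφ : φ < 1) (hc0 : 0 ≤ c)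
    (hc : 2 * φ ≤ c * (1 - φ ^ 2)) (hi : eval v (pderiv i P) / eval v P ≤ φ)
    (hj : eval v (pderiv j P) / eval v P ≤ φ) (hu : u = v + Pi.single i c + Pi.single j c) :
    PositiveAbove (P - pderiv i (pderiv j P)) u ∧
      ∀ k, eval u (pderiv k (P - pderiv i (pderiv j P))) /
        eval u (P - pderiv i (pderiv j P)) ≤ eval v (pderiv k P) / eval v P := by
  have huv : v ≤ u := by
    rw [hu, add_assoc]
    exact le_add_of_nonneg_right (add_nonneg (Pi.single_nonneg.2 hc0) (Pi.single_nonneg.2 hc0))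
  have hpos : PositiveAbove (P - pderiv i (pderiv j P)) u := by
    intro w hw
    have hvw := huv.trans hw
    have hA := hv w hvw
    have h1 := (div_le_iff₀ hA).1 ((hP.pderiv_div_le hv hvw i).trans hi)
    have h2 := (div_le_iff₀ hA).1 ((hP.pderiv_div_le hv hvw j).trans hj)
    have h3 := hP.pderiv_nonneg (hv.mono hvw) i
    have h4 := hP.pderiv_nonneg (hv.mono hvw) j
    have h5 := hP.rayleigh i j w
    rw [map_sub, sub_pos]
    by_contra! h6
    have h7 := mul_le_mul_of_nonneg_left h6 hA.le
    have h8 := mul_le_mul h1 h2 h4 (h3.trans h1)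
    have h9 : 0 ≤ φ := nonneg_of_mul_nonneg_left (h3.trans h1) hA
    have h10 : φ * φ < 1 := mul_lt_one_of_nonneg_of_lt_one_left h9 hφ hφ.le
    nlinarith [mul_lt_mul_of_pos_right h10 (mul_pos hA hA)]
  refine ⟨hpos, fun k => ?_⟩
  have hA := hv u huv
  have hv' := hv.mono huv
  have ht := hP.pderiv_div_tangent_le hv huv k
  have hsum : ∀ f : σ → ℝ, ∑ l, (u l - v l) * f l = c * (f i + f j) := by
    intro f
    simp [hu, Pi.single_apply, add_mul, Finset.sum_add_distrib, mul_add, add_assoc]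
  rw [hsum] at ht
  have hQk : eval u (pderiv k (P - pderiv i (pderiv j P))) =
      eval u (pderiv k P) - eval u (pderiv i (pderiv j (pderiv k P))) := by
    rw [map_sub, map_sub, pderiv_comm k i, pderiv_comm k j]
  have key := sub_le_mul_one_sub_of_rayleigh (a := eval u (pderiv k P) / eval u P)
    (B := eval u (pderiv i P) / eval u P) (C := eval u (pderiv j P) / eval u P)
    (D := eval u (pderiv i (pderiv j P)) / eval u P)
    (B' := eval u (pderiv i (pderiv k P)) / eval u P)
    (C' := eval u (pderiv j (pderiv k P)) / eval u P)
    (D' := eval u (pderiv i (pderiv j (pderiv k P))) / eval u P)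
    (K := eval v (pderiv k P) / eval v P)
    (div_nonneg (hP.pderiv_nonneg hv' i) hA.le)
    (div_nonneg (hP.pderiv_pderiv_nonneg hv' i j) hA.le)
    (div_nonneg (hP.pderiv_nonneg hv' k) hA.le)
    (div_nonneg (hP.pderiv_pderiv_pderiv_nonneg hv' i j k) hA.le)
    ((hP.pderiv_div_le hv huv i).trans hi) ((hP.pderiv_div_le hv huv j).trans hj) hφ hc
    (by
      have := div_nonneg (sub_nonneg.2 (hP.rayleigh i k u)) (sq_nonneg (eval u P))
      refine this.trans_eq ?_
      field_simp)
    (by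
      have := div_nonneg (sub_nonneg.2 (hP.rayleigh j k u)) (sq_nonneg (eval u P))
      refine this.trans_eq ?_
      field_simp)
    (fun y => by
      have := (hP.add_mul_pderiv y k).rayleigh i j u
      simp only [map_add, Derivation.leibniz, pderiv_C, smul_eq_mul, mul_zero, add_zero, map_mul,
        eval_C] at this
      have h := div_le_div_of_nonneg_right this (sq_nonneg (eval u P))
      refine (le_of_eq ?_).trans (h.trans_eq ?_) <;> field_simp)
    (by
      refine le_trans (le_of_eq ?_) ht
      field_simp)
  rw [div_le_iff₀ (hpos u le_rfl), hQk, map_sub]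
  have h := mul_le_mul_of_nonneg_right key hA.le
  rw [sub_mul, div_mul_cancel₀ _ hA.ne', div_mul_cancel₀ _ hA.ne', mul_assoc, sub_mul, one_mul,
    div_mul_cancel₀ _ hA.ne'] at h
  exact h

/-- The operator `1 - ∂ᵢ∂ⱼ` on polynomials. -/
noncomputable def oneSubPderivPderiv (S : Type*) [CommRing S] {σ : Type*} (i j : σ) :
    Module.End S (MvPolynomial σ S) :=
  1 - (pderiv i).toLinearMap ∘ₗ (pderiv j).toLinearMap

theorem oneSubPderivPderiv_apply {S σ : Type*} [CommRing S] (i j : σ) (P : MvPolynomial σ S) :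
    oneSubPderivPderiv S i j P = P - pderiv i (pderiv j P) := rfl

theorem map_prod_oneSubPderivPderiv {S S' ι : Type*} [CommRing S] [CommRing S'] (f : S →+* S')
    (l : List ι) (P : MvPolynomial (ι ⊕ ι) S) :
    map f ((l.map fun i => oneSubPderivPderiv S (Sum.inl i) (Sum.inr i)).prod P) =
      (l.map fun i => oneSubPderivPderiv S' (Sum.inl i) (Sum.inr i)).prod (map f P) := by
  induction l with
  | nil => simp
  | cons i l ih =>
    simp only [List.map_cons, List.prod_cons, Module.End.mul_apply, oneSubPderivPderiv_apply,
      map_sub,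
      ← ih, pderiv_map]

/-- Iterated barrier argument for a product of operators `1 - ∂_{zᵢ}∂_{wᵢ}`. -/
theorem RealStable.prod_oneSubPderivPderiv {ι : Type*} [Fintype ι] [DecidableEq ι]
    {P : MvPolynomial (ι ⊕ ι) ℝ} (hP : RealStable P) {τ : ι → ℝ} (h0 : ∀ i, 0 ≤ τ i)
    (h1 : ∀ i, τ i ≤ 1) (hv : PositiveAbove P fun j => -2 * τ (j.elim id id))
    (hb : ∀ j : ι ⊕ ι, eval (fun j => -2 * τ (j.elim id id)) (pderiv j P) /
      eval (fun j => -2 * τ (j.elim id id)) P ≤ τ (j.elim id id) / 2)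
    {l : List ι} (hl : l.Nodup) :
    RealStable ((l.map fun i => oneSubPderivPderiv ℝ (Sum.inl i) (Sum.inr i)).prod P) ∧
    PositiveAbove ((l.map fun i => oneSubPderivPderiv ℝ (Sum.inl i) (Sum.inr i)).prod P)
      (fun j => if j.elim id id ∈ l then 0 else -2 * τ (j.elim id id)) ∧
    ∀ j : ι ⊕ ι, eval (fun j => if j.elim id id ∈ l then 0 else -2 * τ (j.elim id id))
        (pderiv j ((l.map fun i => oneSubPderivPderiv ℝ (Sum.inl i) (Sum.inr i)).prod P)) /
      eval (fun j => if j.elim id id ∈ l then 0 else -2 * τ (j.elim id id))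
        ((l.map fun i => oneSubPderivPderiv ℝ (Sum.inl i) (Sum.inr i)).prod P) ≤
      τ (j.elim id id) / 2 := by
  induction l with
  | nil =>
    simp only [List.not_mem_nil, if_false]
    exact ⟨hP, hv, hb⟩
  | cons i l ih =>
    obtain ⟨hil, hl⟩ := List.nodup_cons.1 hl
    obtain ⟨hQ, hQv, hQb⟩ := ih hl
    simp only [List.map_cons, List.prod_cons, Module.End.mul_apply, oneSubPderivPderiv_apply]
    have h := hQ.barrier_sub_pderiv_pderiv
      (u := fun j => if j.elim id id ∈ i :: l then 0 else -2 * τ (j.elim id id)) hQv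
      (i := Sum.inl i) (j := Sum.inr i) (φ := τ i / 2) (c := 2 * τ i) (by linarith [h1 i])
      (by linarith [h0 i])
      (by nlinarith [h0 i, h1 i, mul_nonneg (h0 i) (sub_nonneg.2 (h1 i)),
            mul_nonneg (h0 i) (mul_nonneg (h0 i) (sub_nonneg.2 (h1 i)))])
      (hQb _) (hQb _) (by
        ext j
        rcases j with j | j <;> by_cases hj : j = i
        · subst hj
          simp [hil]
        · by_cases hjl : j ∈ l <;> simp [hj, hjl]
        · subst hj
          simp [hil]
        · by_cases hjl : j ∈ l <;> simp [hj, hjl])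
    exact ⟨hQ.sub_pderiv_pderiv _ _, h.1, fun j => (h.2 j).trans (hQb j)⟩

theorem _root_.Matrix.PosSemidef.trace_mul_nonneg {n : Type*} [Fintype n] {A B : Matrix n n ℂ}
    (hA : A.PosSemidef) (hB : B.PosSemidef) : 0 ≤ (A * B).trace := by
  obtain ⟨r, w, rfl⟩ := Matrix.posSemidef_iff_eq_sum_vecMulVec.1 hB
  rw [Matrix.mul_sum, Matrix.trace_sum]
  refine Finset.sum_nonneg fun i _ => ?_
  rw [Matrix.mul_vecMulVec, Matrix.trace_vecMulVec, dotProduct_comm]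
  exact hA.dotProduct_mulVec_nonneg _

omit [Fintype σ] [DecidableEq σ] in
theorem exists_map_ofReal_eq {F : MvPolynomial σ ℂ} (hF : map (starRingEnd ℂ) F = F) :
    ∃ P : MvPolynomial σ ℝ, map (algebraMap ℝ ℂ) P = F := by
  change F ∈ Set.range _
  rw [mem_range_map_iff_coeffs_subset]
  intro c hc
  obtain ⟨d, -, rfl⟩ := mem_coeffs_iff.1 (Finset.mem_coe.1 hc)
  have := congrArg (coeff d) hF
  rw [coeff_map] at this
  exact ⟨_, Complex.conj_eq_iff_re.1 this⟩

variable {ι n : Type*} [Fintype ι] [Fintype n] [DecidableEq n]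

/-- The determinant of the linear pencil `x + ∑ X_{s i} Bᵢ` with variables selected by `s`. -/
noncomputable def pencilDet (B : ι → Matrix n n ℂ) (x : ℂ) (s : ι → σ) : MvPolynomial σ ℂ :=
  (Matrix.of fun a b => C x * (if a = b then 1 else 0) + ∑ i, X (s i) * C (B i a b)).det

omit [Fintype σ] [DecidableEq σ] in
theorem eval_pencilDet (B : ι → Matrix n n ℂ) (x : ℂ) (s : ι → σ) (u : σ → ℂ) :
    eval u (pencilDet B x s) = (x • (1 : Matrix n n ℂ) + ∑ i, u (s i) • B i).det := by
  rw [pencilDet, RingHom.map_det]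
  congr 1
  ext a b
  simp [Matrix.one_apply, Matrix.sum_apply, apply_ite]

theorem eval_pderiv_pencilDet (B : ι → Matrix n n ℂ) (x : ℂ) (s : ι → σ) (u : σ → ℂ) (k : σ)
    (hM : IsUnit (x • (1 : Matrix n n ℂ) + ∑ i, u (s i) • B i).det) :
    eval u (pderiv k (pencilDet B x s)) = (x • (1 : Matrix n n ℂ) + ∑ i, u (s i) • B i).det *
      ((x • (1 : Matrix n n ℂ) + ∑ i, u (s i) • B i)⁻¹ *
        ∑ i, (Pi.single k 1 : σ → ℂ) (s i) • B i).trace := by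
  set M := x • (1 : Matrix n n ℂ) + ∑ i, u (s i) • B i with hMdef
  set N := ∑ i, (Pi.single k 1 : σ → ℂ) (s i) • B i with hN
  have h1 : (Polynomial.derivative (restrictLine u (Pi.single k 1) (pencilDet B x s))).eval 0 =
      eval u (pderiv k (pencilDet B x s)) := by
    simp [eval_derivative_restrictLine, Pi.single_apply]
  have h2 : restrictLine u (Pi.single k 1) (pencilDet B x s) = Polynomial.C M.det *
      (1 + (Polynomial.X : ℂ[X]) • (M⁻¹ * N).map Polynomial.C).det := by
    rw [RingHom.map_det, ← Matrix.det_mul, pencilDet, AlgHom.map_det]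
    congr 1
    have h3 : M.map Polynomial.C * (M⁻¹ * N).map Polynomial.C = N.map Polynomial.C := by
      rw [← Matrix.map_mul, ← mul_assoc, Matrix.mul_nonsing_inv _ hM, one_mul]
    rw [RingHom.mapMatrix_apply, mul_add, mul_one, Matrix.mul_smul, h3]
    ext1 a b
    simp only [restrictLine, AlgHom.mapMatrix_apply, Matrix.map_apply, Matrix.of_apply, map_add,
      map_mul, map_sum, aeval_X, algHom_C, Polynomial.algebraMap_apply, Algebra.algebraMap_self_apply,
      Matrix.add_apply, Matrix.smul_apply, smul_eq_mul, hMdef, hN, Matrix.sum_apply, add_mul,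
      Finset.sum_add_distrib, Finset.mul_sum, Matrix.one_apply, apply_ite, map_zero, map_one,
      add_assoc]
    congr 2
    exact Finset.sum_congr rfl fun i _ => by ring
  rw [← h1, h2, Polynomial.derivative_C_mul, Polynomial.eval_C_mul,
    Matrix.derivative_det_one_add_X_smul]

omit [Fintype σ] [DecidableEq σ] in
theorem map_conj_pencilDet {B : ι → Matrix n n ℂ} (hB : ∀ i, (B i).IsHermitian) (x : ℝ)
    (s : ι → σ) : map (starRingEnd ℂ) (pencilDet B x s) = pencilDet B x s := by
  rw [pencilDet, RingHom.map_det, ← Matrix.det_transpose]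
  congr 1
  ext1 a b
  have h : ∀ i, (starRingEnd ℂ) (B i b a) = B i a b := fun i => (hB i).apply a b
  simp [h, apply_ite, eq_comm]

omit [Fintype σ] [DecidableEq σ] in
theorem upperStable_pencilDet {B : ι → Matrix n n ℂ} (hB : ∀ i, (B i).PosSemidef) {x : ℝ}
    (hx : x ≠ 0) (s : ι → σ) : UpperStable (pencilDet B x s) := by
  intro z hz h0
  rw [eval_pencilDet] at h0
  obtain ⟨v, hv, hMv⟩ := Matrix.exists_mulVec_eq_zero_iff.2 h0
  have hq : ∀ i, ∃ r : ℝ, 0 ≤ r ∧ star v ⬝ᵥ (B i *ᵥ v) = r := fun i => by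
    have h := (hB i).dotProduct_mulVec_nonneg v
    exact ⟨_, (Complex.le_def.1 h).1, Complex.eq_re_of_ofReal_le h⟩
  choose q hq0 hq using hq
  have hvv : star v ⬝ᵥ v = ((star v ⬝ᵥ v).re : ℂ) :=
    Complex.eq_re_of_ofReal_le (dotProduct_star_self_nonneg v)
  have h1 : x * (star v ⬝ᵥ v) + ∑ i, z (s i) * q i = 0 := by
    have := congrArg (fun w => star v ⬝ᵥ w) hMv
    simpa [Matrix.add_mulVec, Matrix.smul_mulVec, Matrix.sum_mulVec, dotProduct_add,
      dotProduct_sum, hq] using this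
  have h2 : ∑ i, (z (s i)).im * q i = 0 := by
    have := congrArg Complex.im h1
    rw [hvv] at this
    simpa using this
  have h3 : ∀ i, q i = 0 := fun i => by
    have := (Finset.sum_eq_zero_iff_of_nonneg fun i _ => mul_nonneg (hz (s i)).le (hq0 i)).1 h2 i
      (Finset.mem_univ i)
    exact (mul_eq_zero.1 this).resolve_left (hz (s i)).ne'
  simp only [h3, Complex.ofReal_zero, mul_zero, Finset.sum_const_zero, add_zero,
    mul_eq_zero] at h1
  exact hv (dotProduct_star_self_eq_zero.1 (h1.resolve_left (by exact_mod_cast hx)))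

theorem _root_.Matrix.PosSemidef.half_sub_inv {N : Matrix n n ℂ} (hN : N.PosSemidef) :
    ((1 / 2 : ℂ) • (1 : Matrix n n ℂ) - ((2 : ℂ) • (1 : Matrix n n ℂ) + N)⁻¹).PosSemidef := by
  set M := (2 : ℂ) • (1 : Matrix n n ℂ) + N with hMdef
  have hM : M.PosDef := (Matrix.PosDef.one.smul two_pos).add_posSemidef hN
  have hu : IsUnit M.det := hM.det_pos.ne'.isUnit
  have h := (hN.add ((hN.pow 2).smul (by simp : (0 : ℂ) ≤ 1 / 2))).mul_mul_conjTranspose_same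
    M⁻¹
  rw [hM.isHermitian.inv.eq] at h
  have e : N + (1 / 2 : ℂ) • N ^ 2 = M * ((1 / 2 : ℂ) • (1 : Matrix n n ℂ) - M⁻¹) * M := by
    rw [mul_sub, Matrix.mul_nonsing_inv _ hu, sub_mul, one_mul, Matrix.mul_smul, mul_one,
      Matrix.smul_mul, hMdef, sq]
    simp only [mul_add, add_mul, Matrix.smul_mul, Matrix.mul_smul, one_mul, mul_one]
    module
  rwa [e, mul_assoc, mul_assoc, mul_assoc, Matrix.mul_nonsing_inv _ hu, mul_one, ← mul_assoc,
    Matrix.nonsing_inv_mul _ hu, one_mul] at h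

theorem _root_.Matrix.PosSemidef.posSemidef_pencil_sub_two {B : ι → Matrix n n ℂ}
    (hB : ∀ i, (B i).PosSemidef)
    (hsum : ((1 : Matrix n n ℂ) - ∑ i, (B i).trace • B i).PosSemidef) {x : ℝ} (hx : 4 ≤ x)
    {u : ι → ℝ} (hu : ∀ i, -2 * (B i).trace.re ≤ u i) :
    ((x : ℂ) • (1 : Matrix n n ℂ) + ∑ i, (u i : ℂ) • B i - (2 : ℂ) • 1).PosSemidef := by
  have h1 : ((x - 4 : ℝ) • (1 : Matrix n n ℂ)).PosSemidef :=
    Matrix.PosSemidef.one.smul (by linarith)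
  have h2 : ((2 : ℝ) • ((1 : Matrix n n ℂ) - ∑ i, (B i).trace • B i)).PosSemidef :=
    hsum.smul (by norm_num)
  have h3 : (∑ i, (u i + 2 * (B i).trace.re) • B i).PosSemidef :=
    Matrix.posSemidef_sum _ fun i _ => (hB i).smul (by linarith [hu i])
  convert (h1.add h2).add h3 using 1
  have h4 : ∀ i, (B i).trace • B i = (B i).trace.re • B i := fun i => by
    conv_lhs => rw [Complex.eq_re_of_ofReal_le (hB i).trace_nonneg]
    rw [Complex.coe_smul]
  have h5 : (2 : ℂ) • (1 : Matrix n n ℂ) = (2 : ℝ) • 1 := (Complex.coe_smul 2 _)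
  simp only [h4, h5, Complex.coe_smul, add_smul, Finset.sum_add_distrib, mul_smul,
    ← Finset.smul_sum]
  module

theorem eval_zero_prod_oneSubPderivPderiv_ne_zero [DecidableEq ι] {B : ι → Matrix n n ℂ}
    (hB : ∀ i, (B i).PosSemidef) (htr : ∀ i, (B i).trace.re ≤ 1)
    (hsum : ((1 : Matrix n n ℂ) - ∑ i, (B i).trace • B i).PosSemidef) {x : ℝ} (hx : 4 ≤ x)
    {l : List ι} (hl : l.Nodup) (hmem : ∀ i, i ∈ l) :
    eval 0 ((l.map fun i => oneSubPderivPderiv ℂ (Sum.inl i) (Sum.inr i)).prod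
      (pencilDet B x Sum.inl * pencilDet B x Sum.inr)) ≠ 0 := by
  obtain ⟨P, hP⟩ := exists_map_ofReal_eq
    (F := (pencilDet B x Sum.inl * pencilDet B x Sum.inr : MvPolynomial (ι ⊕ ι) ℂ))
    (by rw [map_mul, map_conj_pencilDet fun i => (hB i).isHermitian,
      map_conj_pencilDet fun i => (hB i).isHermitian])
  set τ : ι → ℝ := fun i => (B i).trace.re with hτ
  have hτ0 : ∀ i, 0 ≤ τ i := fun i => (Complex.le_def.1 (hB i).trace_nonneg).1
  have hst : RealStable P := fun z hz => by
    rw [hP, map_mul]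
    exact mul_ne_zero (upperStable_pencilDet hB (by linarith) _ z hz)
      (upperStable_pencilDet hB (by linarith) _ z hz)
  have hM2 : ∀ u : ι → ℝ, (∀ i, -2 * τ i ≤ u i) →
      ((x : ℂ) • (1 : Matrix n n ℂ) + ∑ i, (u i : ℂ) • B i - (2 : ℂ) • 1).PosSemidef :=
    fun u hu => Matrix.PosSemidef.posSemidef_pencil_sub_two hB hsum hx hu
  have hdet : ∀ u : ι → ℝ, (∀ i, -2 * τ i ≤ u i) →
      0 < ((x : ℂ) • (1 : Matrix n n ℂ) + ∑ i, (u i : ℂ) • B i).det := fun u hu => by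
    have h2 : ((2 : ℂ) • (1 : Matrix n n ℂ)).PosDef := Matrix.PosDef.one.smul two_pos
    have := h2.add_posSemidef (hM2 u hu)
    rw [add_sub_cancel] at this
    exact this.det_pos
  have hpos : PositiveAbove P fun j => -2 * τ (j.elim id id) := fun u hu => by
    have h := eval_map_ofReal P u
    rw [hP, map_mul, eval_pencilDet, eval_pencilDet] at h
    have h' := mul_pos (hdet (fun i => u (Sum.inl i)) fun i => hu (Sum.inl i))
      (hdet (fun i => u (Sum.inr i)) fun i => hu (Sum.inr i))
    rw [h] at h'
    exact_mod_cast h'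
  have hbar : ∀ j : ι ⊕ ι, eval (fun j => -2 * τ (j.elim id id)) (pderiv j P) /
      eval (fun j => -2 * τ (j.elim id id)) P ≤ τ (j.elim id id) / 2 := fun j => by
    set v : ι ⊕ ι → ℝ := fun j => -2 * τ (j.elim id id) with hv
    set M := (x : ℂ) • (1 : Matrix n n ℂ) + ∑ i, ((-2 * τ i : ℝ) : ℂ) • B i with hMdef
    have hMu : IsUnit M.det := (hdet _ fun i => le_rfl).ne'.isUnit
    have e1 : ((eval v P : ℝ) : ℂ) = M.det * M.det := by
      rw [← eval_map_ofReal, hP, map_mul, eval_pencilDet, eval_pencilDet]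
      rfl
    have e2 : ((eval v (pderiv j P) : ℝ) : ℂ) =
        M.det * M.det * (M⁻¹ * B (j.elim id id)).trace := by
      rw [← eval_map_ofReal, ← pderiv_map, hP, Derivation.leibniz, map_add, smul_eq_mul,
        smul_eq_mul, map_mul, map_mul,
        eval_pderiv_pencilDet B x Sum.inl (fun j => (v j : ℂ)) j hMu,
        eval_pderiv_pencilDet B x Sum.inr (fun j => (v j : ℂ)) j hMu, eval_pencilDet,
        eval_pencilDet]
      change M.det * (M.det * (M⁻¹ * _).trace) + M.det * (M.det * (M⁻¹ * _).trace) = _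
      rw [mul_assoc, ← mul_add, ← mul_add]
      rcases j with j | j <;> simp [Pi.single_apply]
    have e3 : eval v (pderiv j P) = eval v P * (M⁻¹ * B (j.elim id id)).trace.re := by
      have := congrArg Complex.re e2
      rwa [← e1, Complex.ofReal_re, Complex.re_ofReal_mul] at this
    rw [e3, mul_div_cancel_left₀ _ (hpos v le_rfl).ne']
    have h := (Complex.le_def.1 ((hM2 _ fun i => le_rfl).half_sub_inv.trace_mul_nonneg
      (hB (j.elim id id)))).1
    rw [add_sub_cancel, sub_mul, Matrix.trace_sub, Matrix.smul_mul, one_mul, Matrix.trace_smul,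
      Complex.sub_re, smul_eq_mul, Complex.zero_re] at h
    have h6 : ((1 / 2 : ℂ) * (B (j.elim id id)).trace).re = τ (j.elim id id) / 2 := by
      rw [show (1 / 2 : ℂ) = ((1 / 2 : ℝ) : ℂ) by push_cast; rfl, Complex.re_ofReal_mul, hτ]
      ring
    rw [h6] at h
    exact sub_nonneg.1 h
  have h := (hst.prod_oneSubPderivPderiv hτ0 htr hpos hbar hl).2.1 0 fun j => by simp [hmem]
  rw [← hP, ← map_prod_oneSubPderivPderiv]
  have h' := eval_map_ofReal
    ((l.map fun i => oneSubPderivPderiv ℝ (Sum.inl i) (Sum.inr i)).prod P) 0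
  simp only [Pi.zero_apply, Complex.ofReal_zero] at h'
  change eval (fun _ => (0 : ℂ)) _ ≠ 0
  rw [h']
  exact_mod_cast h.ne'

omit [Fintype σ] [DecidableEq σ] in
theorem map_evalRingHom_pencil_det (B : ι → Matrix n n ℂ) (x : ℂ) (s : ι → σ) :
    map (Polynomial.evalRingHom x) (Matrix.of fun a b =>
      (C Polynomial.X * (if a = b then 1 else 0) +
        ∑ i, X (s i) * C (Polynomial.C (B i a b)) : MvPolynomial σ ℂ[X])).det =
      pencilDet B x s := by
  rw [pencilDet, RingHom.map_det]
  congr 1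
  ext1 a b
  simp [apply_ite]

end MvPolynomial

end

/-- every real root of the quadratic mixed characteristic polynomial is
at most `4` (Theorem `qxx`). -/
theorem statement17 {m d : ℕ} (B : Fin m → Matrix (Fin d) (Fin d) ℂ)
    (hB : ∀ i, (B i).PosSemidef)
    (htr : ∀ i, ((B i).trace).re ≤ 1)
    (hsum : ((1 : Matrix (Fin d) (Fin d) ℂ) - ∑ i, (B i).trace • B i).PosSemidef) :
    ∀ x : ℝ, (quadMixedCharPoly B).IsRoot (x : ℂ) → x ≤ 4 := by
  intro x hx
  by_contra! h4
  have h := MvPolynomial.eval_zero_prod_oneSubPderivPderiv_ne_zero hB htr hsum h4.le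
    (List.nodup_finRange m) List.mem_finRange
  apply h
  rw [← MvPolynomial.map_evalRingHom_pencil_det, ← MvPolynomial.map_evalRingHom_pencil_det,
    ← map_mul, ← MvPolynomial.map_prod_oneSubPderivPderiv, MvPolynomial.eval_map]
  rw [Polynomial.IsRoot, quadMixedCharPoly, List.ofFn_eq_map] at hx
  rw [← Polynomial.coe_evalRingHom, MvPolynomial.eval₂_comp] at hx
  have h0 : (0 : Fin m ⊕ Fin m → ℂ) = Polynomial.evalRingHom (x : ℂ) ∘ fun _ => 0 := by
    ext
    simp
  rw [h0]
  exact hx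
end
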